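/- Suppose K is an infinite field and let Q(B) = (λ_1,...,λ_z). Then λ_i − λ_{i+1} ≥ 2 for all i = 1,...,z−1; consequently Q(Q(B)) = Q(B), i.e. the map Q on partitions of n is idempotent. -/

import Mathlib

open Matrix

/-- The Jordan matrix of the partition `μ`. -/
def jordanMatrix (K : Type*) [Field K] (t : ℕ) (μ : Fin t → ℕ) :
    Matrix (Σ i : Fin t, Fin (μ i)) (Σ i : Fin t, Fin (μ i)) K :=
  fun p q => if p.1 = q.1 ∧ (p.2 : ℕ) + 1 = (q.2 : ℕ) then 1 else 0

/-- The vectors `e j` generate `V` under `J`, with `J`-strings of lengths `b j`. -/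
structure IsAdapted {K V ι : Type*} [Field K] [AddCommGroup V] [Module K V] [Fintype ι]
    (J : Module.End K V) (b : ι → ℕ) (e : ι → V) : Prop where
  pow_eq : ∀ j, (J ^ b j) (e j) = 0
  span_eq : Submodule.span K {x | ∃ j a, x = (J ^ a) (e j)} = ⊤
  finrank_eq : Module.finrank K V = ∑ j, b j

/-- The span of the vectors `J ^ a (e j)` with `α j ≤ a`. -/
def tailSpan {K V ι : Type*} [Field K] [AddCommGroup V] [Module K V]
    (J : Module.End K V) (e : ι → V) (α : ι → ℕ) : Submodule K V :=
  Submodule.span K {x | ∃ j a, α j ≤ a ∧ x = (J ^ a) (e j)}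

section Adapted

variable {K V ι : Type*} [Field K] [AddCommGroup V] [Module K V]
  {J : Module.End K V} {b : ι → ℕ} {e : ι → V}

theorem pow_mem_tailSpan {α : ι → ℕ} {j : ι} {a : ℕ} (h : α j ≤ a) :
    (J ^ a) (e j) ∈ tailSpan J e α :=
  Submodule.subset_span ⟨j, a, h, rfl⟩

theorem tailSpan_le_iff {α : ι → ℕ} {S : Submodule K V} :
    tailSpan J e α ≤ S ↔ ∀ j a, α j ≤ a → (J ^ a) (e j) ∈ S := by
  rw [tailSpan, Submodule.span_le]
  constructor
  · exact fun h j a hja => h ⟨j, a, hja, rfl⟩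
  · rintro h _ ⟨j, a, hja, rfl⟩
    exact h j a hja

theorem tailSpan_anti {α β : ι → ℕ} (h : ∀ j, α j ≤ β j) :
    tailSpan J e β ≤ tailSpan J e α :=
  tailSpan_le_iff.2 fun j _ ha => pow_mem_tailSpan ((h j).trans ha)

theorem pow_apply_mem_tailSpan {α β : ι → ℕ} {s : ℕ} (h : ∀ j, β j ≤ α j + s) {x : V}
    (hx : x ∈ tailSpan J e α) : (J ^ s) x ∈ tailSpan J e β := by
  have : tailSpan J e α ≤ (tailSpan J e β).comap (J ^ s) := by
    rw [tailSpan_le_iff]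
    intro j a ha
    rw [Submodule.mem_comap, ← Module.End.mul_apply, ← pow_add]
    exact pow_mem_tailSpan (by have := h j; omega)
  exact this hx

theorem map_pow_tailSpan (α : ι → ℕ) (s : ℕ) :
    (tailSpan J e α).map (J ^ s) = tailSpan J e fun j => α j + s := by
  apply le_antisymm
  · rintro _ ⟨x, hx, rfl⟩
    exact pow_apply_mem_tailSpan (fun _ => le_rfl) hx
  · rw [tailSpan_le_iff]
    intro j a ha
    refine ⟨(J ^ (a - s)) (e j), pow_mem_tailSpan (by omega), ?_⟩
    rw [← Module.End.mul_apply, ← pow_add]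
    congr 2
    omega

theorem map_tailSpan_le {A : Module.End K V} (hA : Commute A J) {α γ : ι → ℕ} {β : ι → ι → ℕ}
    (hβ : ∀ j, A (e j) ∈ tailSpan J e (β j)) (h : ∀ j i, γ i ≤ β j i + α j) :
    (tailSpan J e α).map A ≤ tailSpan J e γ := by
  rw [Submodule.map_le_iff_le_comap, tailSpan_le_iff]
  intro j a ha
  rw [Submodule.mem_comap, ← Module.End.mul_apply, (hA.pow_right a).eq, Module.End.mul_apply]
  exact pow_apply_mem_tailSpan (fun i => by have := h j i; omega) (hβ j)

variable [Fintype ι]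

theorem IsAdapted.pow_eq_zero (h : IsAdapted J b e) {j : ι} {a : ℕ} (ha : b j ≤ a) :
    (J ^ a) (e j) = 0 := by
  obtain ⟨c, rfl⟩ := Nat.exists_eq_add_of_le' ha
  rw [pow_add, Module.End.mul_apply, h.pow_eq, map_zero]

theorem IsAdapted.tailSpan_zero (h : IsAdapted J b e) {α : ι → ℕ} (hα : ∀ j, α j = 0) :
    tailSpan J e α = ⊤ := by
  rw [← h.span_eq, tailSpan]
  simp [hα]

theorem IsAdapted.exists_basis [FiniteDimensional K V] (h : IsAdapted J b e) :
    ∃ B : Module.Basis (Σ j, Fin (b j)) K V, ∀ x, B x = (J ^ (x.2 : ℕ)) (e x.1) := by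
  let f : (Σ j, Fin (b j)) → V := fun x => (J ^ (x.2 : ℕ)) (e x.1)
  have hspan : ⊤ ≤ Submodule.span K (Set.range f) := by
    rw [← h.span_eq, Submodule.span_le]
    rintro _ ⟨j, a, rfl⟩
    by_cases ha : a < b j
    · exact Submodule.subset_span ⟨⟨j, ⟨a, ha⟩⟩, rfl⟩
    · rw [h.pow_eq_zero (not_lt.1 ha)]
      exact zero_mem _
  refine ⟨basisOfTopLeSpanOfCardEqFinrank f hspan (by simp [h.finrank_eq]), fun x => ?_⟩
  rw [coe_basisOfTopLeSpanOfCardEqFinrank]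

theorem IsAdapted.isNilpotent [FiniteDimensional K V] (h : IsAdapted J b e) : IsNilpotent J := by
  refine ⟨∑ j, b j, ?_⟩
  obtain ⟨B, hB⟩ := h.exists_basis
  refine B.ext fun x => ?_
  rw [hB, ← Module.End.mul_apply, ← pow_add, LinearMap.zero_apply]
  exact h.pow_eq_zero ((Finset.single_le_sum (f := b) (fun _ _ => Nat.zero_le _)
    (Finset.mem_univ x.1)).trans (by omega))

theorem card_sigma_fin_le (b α : ι → ℕ) :
    Nat.card {x : Σ j, Fin (b j) // α x.1 ≤ x.2} = ∑ j, (b j - α j) := by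
  have e : {x : Σ j, Fin (b j) // α x.1 ≤ x.2} ≃ Σ j, {a : Fin (b j) // α j ≤ a} :=
    { toFun := fun x => ⟨x.1.1, ⟨x.1.2, x.2⟩⟩
      invFun := fun x => ⟨⟨x.1, x.2.1⟩, x.2.2⟩
      left_inv := fun _ => rfl
      right_inv := fun _ => rfl }
  rw [Nat.card_congr e, Nat.card_sigma]
  refine Finset.sum_congr rfl fun j _ => ?_
  have e' : {a : Fin (b j) // α j ≤ a} ≃ Fin (b j - α j) :=
    { toFun := fun x => ⟨x.1 - α j, by have := x.1.2; have := x.2; omega⟩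
      invFun := fun x => ⟨⟨x + α j, by omega⟩, by simp⟩
      left_inv := fun x => by ext; simp [x.2]
      right_inv := fun x => by ext; simp }
  rw [Nat.card_congr e', Nat.card_fin]

theorem IsAdapted.finrank_tailSpan [FiniteDimensional K V] (h : IsAdapted J b e) (α : ι → ℕ) :
    Module.finrank K (tailSpan J e α) = ∑ j, (b j - α j) := by
  classical
  obtain ⟨B, hB⟩ := h.exists_basis
  let g : {x : Σ j, Fin (b j) // α x.1 ≤ x.2} → V := fun x => B x.1
  have hg : LinearIndependent K g := B.linearIndependent.comp _ Subtype.val_injective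
  have heq : tailSpan J e α = Submodule.span K (Set.range g) := by
    apply le_antisymm
    · rw [tailSpan_le_iff]
      intro j a ha
      by_cases hab : a < b j
      · exact Submodule.subset_span ⟨⟨⟨j, ⟨a, hab⟩⟩, ha⟩, hB _⟩
      · rw [h.pow_eq_zero (not_lt.1 hab)]
        exact zero_mem _
    · rw [Submodule.span_le]
      rintro _ ⟨x, rfl⟩
      simp only [g, hB]
      exact pow_mem_tailSpan x.2
  rw [heq, finrank_span_eq_card hg, ← card_sigma_fin_le, Nat.card_eq_fintype_card]

theorem IsAdapted.range_pow (h : IsAdapted J b e) (i : ℕ) :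
    LinearMap.range (J ^ i) = tailSpan J e fun _ => i := by
  rw [LinearMap.range_eq_map, ← h.tailSpan_zero (α := fun _ => 0) (fun _ => rfl),
    map_pow_tailSpan]
  simp

theorem IsAdapted.finrank_range_pow [FiniteDimensional K V] (h : IsAdapted J b e) (i : ℕ) :
    Module.finrank K (LinearMap.range (J ^ i)) = ∑ j, (b j - i) := by
  rw [h.range_pow, h.finrank_tailSpan]

theorem IsAdapted.ker_pow [FiniteDimensional K V] (h : IsAdapted J b e) (v : ℕ) :
    LinearMap.ker (J ^ v) = tailSpan J e fun j => b j - v := by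
  symm
  apply Submodule.eq_of_le_of_finrank_eq
  · rw [tailSpan_le_iff]
    intro j a ha
    rw [LinearMap.mem_ker, ← Module.End.mul_apply, ← pow_add]
    exact h.pow_eq_zero (by omega)
  · have h1 := LinearMap.finrank_range_add_finrank_ker (J ^ v)
    rw [h.finrank_range_pow, h.finrank_eq] at h1
    rw [h.finrank_tailSpan]
    have : ∑ j, b j = ∑ j, (b j - v) + ∑ j, (b j - (b j - v)) := by
      rw [← Finset.sum_add_distrib]
      exact Finset.sum_congr rfl fun j _ => by omega
    omega

theorem IsAdapted.exists_lift [FiniteDimensional K V] {V' : Type*} [AddCommGroup V'] [Module K V']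
    (h : IsAdapted J b e) (J' : Module.End K V') (u : ι → V') (hu : ∀ j, (J' ^ b j) (u j) = 0) :
    ∃ f : V →ₗ[K] V', (∀ x, f (J x) = J' (f x)) ∧ ∀ j, f (e j) = u j := by
  obtain ⟨B, hB⟩ := h.exists_basis
  let f := B.constr K fun x => (J' ^ (x.2 : ℕ)) (u x.1)
  have hf : ∀ j a, f ((J ^ a) (e j)) = (J' ^ a) (u j) := by
    intro j a
    by_cases ha : a < b j
    · rw [← hB ⟨j, ⟨a, ha⟩⟩, Module.Basis.constr_basis]
    · obtain ⟨c, rfl⟩ := Nat.exists_eq_add_of_le' (not_lt.1 ha)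
      rw [h.pow_eq_zero (by omega), pow_add, Module.End.mul_apply, hu]
      simp
  refine ⟨f, fun x => ?_, fun j => by simpa using hf j 0⟩
  suffices f ∘ₗ J = J' ∘ₗ f from LinearMap.congr_fun this x
  refine B.ext fun x => ?_
  simp only [LinearMap.comp_apply, hB]
  rw [← Module.End.mul_apply, ← pow_succ', hf, hf, pow_succ', Module.End.mul_apply]

theorem IsAdapted.hom_ext {V' : Type*} [AddCommGroup V'] [Module K V'] (h : IsAdapted J b e)
    {J' : Module.End K V'} {f g : V →ₗ[K] V'} (hf : ∀ x, f (J x) = J' (f x))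
    (hg : ∀ x, g (J x) = J' (g x)) (hfg : ∀ j, f (e j) = g (e j)) : f = g := by
  refine LinearMap.ext_on h.span_eq ?_
  rintro _ ⟨j, a, rfl⟩
  induction a with
  | zero => simpa using hfg j
  | succ a ih => rw [pow_succ', Module.End.mul_apply, hf, hg, ih]

end Adapted

section Types

theorem exists_isAdapted_jordanMatrix (K : Type*) [Field K] {t : ℕ} (b : Fin t → ℕ) :
    ∃ e, IsAdapted (Matrix.toLin' (jordanMatrix K t b)) b e := by
  classical
  let J := Matrix.toLin' (jordanMatrix K t b)
  let g : Fin t → ℕ → (Σ i : Fin t, Fin (b i)) → K :=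
    fun i c p => if p.1 = i ∧ (p.2 : ℕ) + 1 = c then 1 else 0
  have hJ : ∀ i c, c + 1 ≤ b i → J (g i (c + 1)) = g i c := by
    intro i c hc
    ext ⟨k, p⟩
    simp only [J, g, Matrix.toLin'_apply, Matrix.mulVec, dotProduct, jordanMatrix]
    rw [Finset.sum_eq_single ⟨i, ⟨c, hc⟩⟩]
    · simp
    · rintro ⟨j, q⟩ - hne
      by_cases hji : j = i
      · subst hji
        have : (q : ℕ) ≠ c := fun h => hne (by subst h; rfl)
        simp [this]
      · simp [hji]
    · simp
  have hpow : ∀ i a, a ≤ b i → (J ^ a) (g i (b i)) = g i (b i - a) := by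
    intro i a
    induction a with
    | zero => simp
    | succ a ih =>
      intro ha
      rw [pow_succ', Module.End.mul_apply, ih (by omega), ← hJ i (b i - (a + 1)) (by omega)]
      congr 2
      omega
  refine ⟨fun i => g i (b i), fun i => ?_, ?_, by simp⟩
  · refine (hpow i _ le_rfl).trans ?_
    ext p
    simp [g]
  · rw [eq_top_iff, ← (Pi.basisFun K _).span_eq, Submodule.span_le]
    rintro _ ⟨⟨i, c⟩, rfl⟩
    refine Submodule.subset_span ⟨i, b i - (c + 1), ?_⟩
    refine Eq.trans ?_ (hpow i _ (by omega)).symm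
    have hc : b i - (b i - ((c : ℕ) + 1)) = c + 1 := by omega
    rw [hc]
    ext ⟨k, p⟩
    simp only [Pi.basisFun_apply, Pi.single_apply, g, Nat.add_right_cancel_iff]
    congr 1
    by_cases hki : k = i
    · subst hki
      simp [Fin.ext_iff]
    · simp [hki]

theorem exists_antitone_pos {ι : Type*} [Fintype ι] (b : ι → ℕ) :
    ∃ (t : ℕ) (b' : Fin t → ℕ), Antitone b' ∧ (∀ i, 0 < b' i) ∧
      ∀ s, ∑ j, (b' j - s) = ∑ j, (b j - s) := by
  let l := ((Finset.univ.val.map b).filter (0 < ·)).sort (· ≥ ·)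
  have hl : ∀ i : Fin l.length, 0 < l.get i := fun i => by
    have := List.get_mem l i
    simp only [l, Multiset.mem_sort, Multiset.mem_filter] at this
    exact this.2
  refine ⟨l.length, l.get, ?_, hl, fun s => ?_⟩
  · have : l.Pairwise (· ≥ ·) := Multiset.pairwise_sort ..
    intro i j hij
    rcases hij.eq_or_lt with rfl | h
    · rfl
    · exact List.pairwise_iff_get.1 this i j h
  · have h1 : ∑ j, (l.get j - s) = (l.map (· - s)).sum := by
      rw [← List.sum_ofFn]
      congr 1
      conv_rhs => rw [← List.ofFn_get l, List.map_ofFn]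
      rfl
    rw [h1, ← Multiset.sum_coe, ← Multiset.map_coe, Multiset.sort_eq]
    have h2 : ∀ m : Multiset ℕ, ((m.filter (0 < ·)).map (· - s)).sum = (m.map (· - s)).sum := by
      intro m
      induction m using Multiset.induction with
      | empty => simp
      | cons a m ih =>
        by_cases ha : 0 < a
        · simp [ha, ih]
        · obtain rfl : a = 0 := by omega
          simp [ih]
    rw [h2, Multiset.map_map]
    rfl

theorem sum_sub_add_sum_sub {ι : Type*} [Fintype ι] (b : ι → ℕ) {v : ℕ} (hv : 0 < v) :
    ∑ j, (b j - (v - 1)) + ∑ j, (b j - (v + 1)) =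
      2 * ∑ j, (b j - v) + Fintype.card {j // b j = v} := by
  rw [Fintype.card_subtype, Finset.card_filter, Finset.mul_sum, ← Finset.sum_add_distrib,
    ← Finset.sum_add_distrib]
  refine Finset.sum_congr rfl fun j _ => ?_
  split_ifs <;> omega

theorem card_eq_of_sum_sub_eq {ι κ : Type*} [Fintype ι] [Fintype κ] {b : ι → ℕ} {k : κ → ℕ}
    (h : ∀ s, ∑ j, (b j - s) = ∑ j, (k j - s)) {v : ℕ} (hv : 0 < v) :
    Fintype.card {j // b j = v} = Fintype.card {j // k j = v} := by
  have h1 := sum_sub_add_sum_sub b hv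
  have h2 := sum_sub_add_sum_sub k hv
  have := h (v - 1)
  have := h v
  have := h (v + 1)
  omega

variable {K V : Type*} [Field K] [AddCommGroup V] [Module K V]
  {J : Module.End K V}

theorem IsAdapted.exists_of_sum_eq {ι κ : Type*} [Fintype ι] [Fintype κ] {b : ι → ℕ} {k : κ → ℕ}
    {e : κ → V} (he : IsAdapted J k e) (h : ∀ s, ∑ j, (b j - s) = ∑ j, (k j - s)) :
    ∃ e', IsAdapted J b e' := by
  classical
  have hc : ∀ v, 0 < v → Nonempty ({j // b j = v} ≃ {j // k j = v}) := fun v hv =>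
    ⟨Fintype.equivOfCardEq (card_eq_of_sum_sub_eq h hv)⟩
  let σ := fun v hv => (hc v hv).some
  let e' : ι → V := fun j => if hj : 0 < b j then e (σ (b j) hj ⟨j, rfl⟩) else 0
  have he' : ∀ v hv (j : {j // b j = v}), e' j = e (σ v hv j) := by
    rintro _ hv ⟨j, rfl⟩
    exact dif_pos hv
  refine ⟨e', fun j => ?_, ?_, by simpa [he.finrank_eq] using (h 0).symm⟩
  · by_cases hj : 0 < b j
    · rw [he' _ hj ⟨j, rfl⟩]
      exact he.pow_eq_zero (σ (b j) hj ⟨j, rfl⟩).2.le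
    · simp [e', hj]
  · rw [eq_top_iff, ← he.span_eq, Submodule.span_le]
    rintro _ ⟨i, a, rfl⟩
    by_cases hi : 0 < k i
    · refine Submodule.subset_span ⟨(σ (k i) hi).symm ⟨i, rfl⟩, a, ?_⟩
      rw [he' (k i) hi]
      simp
    · rw [he.pow_eq_zero (by omega)]
      exact zero_mem _

variable [FiniteDimensional K V]

open Polynomial DirectSum in
theorem exists_isAdapted_of_isNilpotent (hJ : IsNilpotent J) :
    ∃ (t : ℕ) (k : Fin t → ℕ) (e : Fin t → V), IsAdapted J k e := by
  classical
  obtain ⟨N, hN⟩ := hJ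
  have hX : ∀ n v, (X : K[X]) ^ n • Module.AEval'.of J v = Module.AEval'.of J ((J ^ n) v) :=
    fun n v => Module.AEval'.X_pow_smul_of J v n
  have htors : Module.IsTorsion' (Module.AEval' J) (Submonoid.powers (X : K[X])) := by
    intro x
    refine ⟨⟨X ^ N, N, rfl⟩, ?_⟩
    obtain ⟨v, rfl⟩ := (Module.AEval'.of J).surjective x
    change (X : K[X]) ^ N • Module.AEval'.of J v = 0
    rw [hX, hN, LinearMap.zero_apply, map_zero]
  obtain ⟨t, k, ⟨f⟩⟩ := Module.torsion_by_prime_power_decomposition Polynomial.irreducible_X htors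
  let e : Fin t → V := fun i =>
    (Module.AEval'.of J).symm (f.symm (DirectSum.lof K[X] _ _ i (Submodule.Quotient.mk 1)))
  have he : ∀ i, Module.AEval'.of J (e i) =
      f.symm (DirectSum.lof K[X] _ _ i (Submodule.Quotient.mk 1)) := fun i => by simp [e]
  refine ⟨t, k, e, fun i => ?_, ?_, ?_⟩
  · apply (Module.AEval'.of J).injective
    rw [map_zero, ← hX, he, ← map_smul, ← map_smul, ← Submodule.Quotient.mk_smul]
    rw [(Submodule.Quotient.mk_eq_zero _).2 (by simp), map_zero,
      map_zero]
  · rw [eq_top_iff]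
    rintro x -
    have key : ∀ y, (Module.AEval'.of J).symm (f.symm y) ∈
        Submodule.span K {x | ∃ j a, x = (J ^ a) (e j)} := by
      intro y
      induction y using DirectSum.induction_on with
      | zero => simp
      | add y z hy hz =>
        rw [map_add, map_add]
        exact add_mem hy hz
      | of i q =>
        obtain ⟨p, rfl⟩ := Submodule.Quotient.mk_surjective _ q
        have : DirectSum.of (fun i => K[X] ⧸ K[X] ∙ (X : K[X]) ^ k i) i (Submodule.Quotient.mk p)
            = p • DirectSum.lof K[X] _ _ i (Submodule.Quotient.mk 1) := by
          rw [← map_smul, ← Submodule.Quotient.mk_smul, smul_eq_mul, mul_one]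
          rfl
        rw [this, map_smul, ← he, ← Module.AEval.of_aeval_smul, LinearEquiv.symm_apply_apply,
          Polynomial.aeval_eq_sum_range, Finset.sum_smul]
        exact sum_mem fun n _ => by
          rw [smul_assoc]
          exact Submodule.smul_mem _ _ (Submodule.subset_span ⟨i, n, rfl⟩)
    simpa using key (f (Module.AEval'.of J x))
  · have h1 : Module.finrank K V = Module.finrank K (⨁ i : Fin t, K[X] ⧸ K[X] ∙ (X : K[X]) ^ k i) :=
      ((Module.AEval'.of J).trans (f.restrictScalars K)).finrank_eq
    have : ∀ i, Module.Finite K (K[X] ⧸ K[X] ∙ (X : K[X]) ^ k i) := fun i =>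
      (Polynomial.monic_X_pow (k i)).finite_adjoinRoot
    rw [h1, Module.finrank_directSum]
    refine Finset.sum_congr rfl fun i _ => ?_
    rw [finrank_quotient_span_eq_natDegree]
    simp

theorem exists_isAdapted_of_finrank_range {ι : Type*} [Fintype ι] {b : ι → ℕ}
    (hJ : IsNilpotent J)
    (h : ∀ i, Module.finrank K (LinearMap.range (J ^ i)) = ∑ j, (b j - i)) :
    ∃ e, IsAdapted J b e := by
  obtain ⟨t, k, e, he⟩ := exists_isAdapted_of_isNilpotent hJ
  exact he.exists_of_sum_eq fun s => by rw [← h, he.finrank_range_pow]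

theorem IsAdapted.exists_linearEquiv {ι : Type*} [Fintype ι] {b : ι → ℕ} {e : ι → V}
    (he : IsAdapted J b e) {V' : Type*} [AddCommGroup V'] [Module K V'] [FiniteDimensional K V']
    {J' : Module.End K V'} {e' : ι → V'} (he' : IsAdapted J' b e') :
    ∃ f : V ≃ₗ[K] V', ∀ x, f (J x) = J' (f x) := by
  obtain ⟨f, hf, hfe⟩ := he.exists_lift J' e' he'.pow_eq
  obtain ⟨g, hg, hge⟩ := he'.exists_lift J e he.pow_eq
  refine ⟨LinearEquiv.ofLinearMap f g ?_ ?_, hf⟩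
  · exact he'.hom_ext (J' := J') (by simp [hf, hg]) (by simp) (by simp [hfe, hge])
  · exact he.hom_ext (J' := J) (by simp [hf, hg]) (by simp) (by simp [hfe, hge])

end Types

section Triangular

/-- The order in `J` that the coefficient of `e i` in `A (e j)` has when `A` is strictly
triangular with respect to the generators `e`. -/
def triOff {t : ℕ} (b : Fin t → ℕ) (j i : Fin t) : ℕ :=
  (b i - b j) + if b i = b j ∧ i ≤ j then 1 else 0

/-- `A` is strictly triangular with respect to the generators `e`. -/
def IsTriangular {K V : Type*} [Field K] [AddCommGroup V] [Module K V] {t : ℕ}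
    (J : Module.End K V) (b : Fin t → ℕ) (e : Fin t → V) (A : Module.End K V) : Prop :=
  ∀ j, A (e j) ∈ tailSpan J e (triOff b j)

variable {K V : Type*} [Field K] [AddCommGroup V] [Module K V]
  {J A : Module.End K V} {t : ℕ} {b : Fin t → ℕ} {e : Fin t → V}

theorem IsTriangular.isNilpotent (he : IsAdapted J b e) (hA : Commute A J)
    (hU : IsTriangular J b e A) : IsNilpotent A := by
  set B := ∑ j, b j with hB
  have hb : ∀ j, b j ≤ B := fun j =>
    Finset.single_le_sum (f := b) (fun _ _ => Nat.zero_le _) (Finset.mem_univ j)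
  have key : ∀ k j a, (3 * B + 1) * t ≤ (2 * a + B - b j) * t + j + k →
      (A ^ k) ((J ^ a) (e j)) = 0 := by
    intro k
    induction k with
    | zero =>
      intro j a h
      have hj := j.2
      have h1 : (3 * B + 1) * t < (2 * a + B - b j + 1) * t := by
        rw [add_mul (2 * a + B - b j)]
        omega
      have h2 := Nat.lt_of_mul_lt_mul_right h1
      have := hb j
      simpa using he.pow_eq_zero (show b j ≤ a by omega)
    | succ k ih =>
      intro j a h
      rw [pow_succ, Module.End.mul_apply]
      suffices hle : A ((J ^ a) (e j)) ∈ LinearMap.ker (A ^ k) from hle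
      have h1 : A ((J ^ a) (e j)) ∈ tailSpan J e fun i => triOff b j i + a := by
        rw [← Module.End.mul_apply, (hA.pow_right a).eq, Module.End.mul_apply]
        exact pow_apply_mem_tailSpan (fun _ => le_rfl) (hU j)
      refine tailSpan_le_iff.2 (fun i c hc => ?_) h1
      refine ih i c ?_
      have hji := hb j
      have hbi := hb i
      have hj := j.2
      have hi := i.2
      simp only [triOff] at hc
      by_cases hlt : b i = b j ∧ j < i
      · have : 2 * a + B - b j ≤ 2 * c + B - b i := by omega
        have := Nat.mul_le_mul_right t this
        have : (j : ℕ) < i := hlt.2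
        omega
      · have : 2 * a + B - b j + 1 ≤ 2 * c + B - b i := by
          split_ifs at hc with hs
          · omega
          · have : b i ≠ b j := fun h => by
              rcases le_or_gt i j with h' | h'
              · exact hs ⟨h, h'⟩
              · exact hlt ⟨h, h'⟩
            omega
        have := Nat.mul_le_mul_right t this
        rw [add_mul] at this
        omega
  refine ⟨(3 * B + 1) * t, ?_⟩
  have : (⊤ : Submodule K V) ≤ LinearMap.ker (A ^ ((3 * B + 1) * t)) := by
    rw [← he.span_eq, Submodule.span_le]
    rintro _ ⟨j, a, rfl⟩
    exact key _ j a (by omega)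
  exact LinearMap.ker_eq_top.1 (top_le_iff.1 this)

variable [FiniteDimensional K V]

theorem exists_strictly_triangular_basis {I X : Type*} [Fintype I] [LinearOrder I] [AddCommGroup X]
    [Module K X] [FiniteDimensional K X] (hX : Module.finrank K X = Fintype.card I)
    {N : Module.End K X} (hN : IsNilpotent N) :
    ∃ x : Module.Basis I K X, ∀ i, N (x i) ∈ Submodule.span K {y | ∃ k, i < k ∧ y = x k} := by
  classical
  obtain ⟨d, k, e, he⟩ := exists_isAdapted_of_isNilpotent hN
  obtain ⟨B, hB⟩ := he.exists_basis
  have hc : Fintype.card (Σ j, Fin (k j)) = Fintype.card I := by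
    rw [← hX, Module.finrank_eq_card_basis B]
  let σ : Fin (Fintype.card I) ≃ Σ j, Fin (k j) := Fintype.equivFinOfCardEq hc |>.symm
  let g : (Σ j, Fin (k j)) → ℕ := fun p => p.2
  let f : Fin (Fintype.card I) → ℕ := g ∘ σ
  let τ : (Σ j, Fin (k j)) ≃ I :=
    (((Tuple.sort f).trans σ).symm).trans (Fintype.orderIsoFinOfCardEq I rfl).toEquiv
  have hτ : ∀ p q : Σ j, Fin (k j), (p.2 : ℕ) < q.2 → τ p < τ q := by
    intro p q hpq
    simp only [τ, Equiv.trans_apply]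
    refine (Fintype.orderIsoFinOfCardEq I rfl).strictMono (lt_of_not_ge fun h => ?_)
    have := Tuple.monotone_sort f h
    have hσ : ∀ p, σ (Tuple.sort f (((Tuple.sort f).trans σ).symm p)) = p :=
      fun p => ((Tuple.sort f).trans σ).apply_symm_apply p
    simp only [f, Function.comp_apply] at this hσ
    rw [hσ, hσ] at this
    exact absurd hpq (not_lt.2 this)
  refine ⟨B.reindex τ, fun i => ?_⟩
  obtain ⟨⟨j, a⟩, rfl⟩ := τ.surjective i
  rw [Module.Basis.reindex_apply, Equiv.symm_apply_apply, hB, ← Module.End.mul_apply, ← pow_succ']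
  by_cases ha : (a : ℕ) + 1 < k j
  · refine Submodule.subset_span ⟨τ ⟨j, ⟨a + 1, ha⟩⟩, hτ _ _ (by simp), ?_⟩
    rw [Module.Basis.reindex_apply, Equiv.symm_apply_apply, hB]
  · rw [he.pow_eq_zero (by simp only; omega)]
    exact zero_mem _

/-- The offsets describing `ker J ^ (v - 1) + J (ker J ^ (v + 1))`. -/
def valOff {ι : Type*} (b : ι → ℕ) (v : ℕ) (i : ι) : ℕ :=
  (b i - v) + if b i = v then 1 else 0

theorem exists_triangular_class (he : IsAdapted J b e) (hA : Commute A J) (hAn : IsNilpotent A)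
    {v : ℕ} (hv : 0 < v) :
    ∃ x : {i // b i = v} → V,
      (∀ i, x i ∈ Submodule.span K {y | ∃ k, b k = v ∧ y = e k}) ∧
      (∀ i, b i = v → e i ∈ Submodule.span K (Set.range x)) ∧
      ∀ i, A (x i) ∈ Submodule.span K {y | ∃ k, i < k ∧ y = x k} ⊔ tailSpan J e (valOff b v) := by
  obtain ⟨B, hB⟩ := he.exists_basis
  let I := {i // b i = v}
  have hI : ∀ i : I, 0 < b i := fun i => i.2.symm ▸ hv
  let s : (I → K) →ₗ[K] V := Fintype.linearCombination K (fun i : I => e i)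
  let p : V →ₗ[K] (I → K) := LinearMap.pi fun i => B.coord ⟨i, ⟨0, hI i⟩⟩
  have hps : ∀ i : I, p (e i) = Pi.single i 1 := by
    intro i
    have : e i = B ⟨i, ⟨0, hI i⟩⟩ := by simp [hB]
    ext k
    rw [this]
    simp only [p, LinearMap.pi_apply, Module.Basis.coord_apply, Module.Basis.repr_self,
      Finsupp.single_apply, Pi.single_apply]
    congr 1
    refine propext ⟨fun h => Subtype.ext (congrArg Sigma.fst h).symm, fun h => by rw [h]⟩
  have hpY : ∀ y ∈ tailSpan J e (valOff b v), p y = 0 := by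
    suffices tailSpan J e (valOff b v) ≤ LinearMap.ker p from fun y hy => this hy
    rw [tailSpan_le_iff]
    intro j a ha
    rw [LinearMap.mem_ker]
    by_cases hab : a < b j
    · ext i
      have : (J ^ a) (e j) = B ⟨j, ⟨a, hab⟩⟩ := by simp [hB]
      rw [this]
      simp only [p, LinearMap.pi_apply, Module.Basis.coord_apply, Module.Basis.repr_self]
      refine Finsupp.single_eq_of_ne fun h => ?_
      have h1 : (i : Fin t) = j := congrArg Sigma.fst h
      have h2 : 0 = a := congrArg (fun q : Σ j, Fin (b j) => (q.2 : ℕ)) h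
      have := i.2
      rw [h1] at this
      simp [valOff, this] at ha
      omega
    · rw [he.pow_eq_zero (not_lt.1 hab), map_zero]
  have hpsx : ∀ x, p (s x) = x := by
    intro x
    simp only [s, Fintype.linearCombination_apply, map_sum, map_smul, hps]
    ext i
    simp [Pi.single_apply]
  have hker : ∀ y ∈ tailSpan J e (fun i => b i - v), y - s (p y) ∈ tailSpan J e (valOff b v) := by
    suffices tailSpan J e (fun i => b i - v) ≤
        (tailSpan J e (valOff b v)).comap (LinearMap.id - s ∘ₗ p) from fun y hy => this hy
    rw [tailSpan_le_iff]
    intro j a ha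
    change (J ^ a) (e j) - s (p ((J ^ a) (e j))) ∈ tailSpan J e (valOff b v)
    by_cases h : valOff b v j ≤ a
    · have := pow_mem_tailSpan (J := J) (e := e) h
      rw [hpY _ this, map_zero, sub_zero]
      exact this
    · have hj : b j = v := by
        by_contra hne
        simp [valOff, hne] at h
        omega
      have ha0 : a = 0 := by
        simp [valOff, hj] at h
        omega
      subst ha0
      have := hps ⟨j, hj⟩
      simp only at this
      rw [pow_zero, Module.End.one_apply, this]
      simp [s]
  have hs : ∀ x, s x ∈ tailSpan J e (fun i => b i - v) := by
    intro x
    rw [← he.ker_pow, LinearMap.mem_ker]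
    simp only [s, Fintype.linearCombination_apply, map_sum, map_smul]
    exact Finset.sum_eq_zero fun i _ => by rw [he.pow_eq_zero i.2.le, smul_zero]
  have hAe : ∀ j, A (e j) ∈ tailSpan J e fun i => b i - b j := by
    intro j
    rw [← he.ker_pow, LinearMap.mem_ker, ← Module.End.mul_apply, ← (hA.pow_right _).eq,
      Module.End.mul_apply, he.pow_eq, map_zero]
  have hAY : ∀ y ∈ tailSpan J e (valOff b v), A y ∈ tailSpan J e (valOff b v) := by
    intro y hy
    refine map_tailSpan_le (β := fun j i => b i - b j) hA hAe (fun j i => ?_) ⟨y, hy, rfl⟩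
    simp only [valOff]
    split_ifs <;> omega
  have hAk : ∀ y ∈ tailSpan J e (fun i => b i - v), A y ∈ tailSpan J e (fun i => b i - v) := by
    intro y hy
    exact map_tailSpan_le (β := fun j i => b i - b j) hA hAe (fun j i => by omega) ⟨y, hy, rfl⟩
  let N : Module.End K (I → K) := p ∘ₗ A ∘ₗ s
  have hNs : ∀ x, A (s x) - s (N x) ∈ tailSpan J e (valOff b v) := fun x => hker _ (hAk _ (hs x))
  have hNpow : ∀ m x, (A ^ m) (s x) - s ((N ^ m) x) ∈ tailSpan J e (valOff b v) := by
    intro m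
    induction m with
    | zero => simp
    | succ m ih =>
      intro x
      have := add_mem (hAY _ (ih x)) (hNs ((N ^ m) x))
      rw [map_sub, sub_add_sub_cancel] at this
      rwa [pow_succ', pow_succ', Module.End.mul_apply, Module.End.mul_apply]
  have hN : IsNilpotent N := by
    obtain ⟨m, hm⟩ := hAn
    refine ⟨m, LinearMap.ext fun x => ?_⟩
    have := hpY _ (hNpow m x)
    rwa [hm, LinearMap.zero_apply, zero_sub, map_neg, hpsx, neg_eq_zero] at this
  obtain ⟨x, hx⟩ := exists_strictly_triangular_basis (I := I) (by simp) hN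
  refine ⟨fun i => s (x i), fun i => ?_, fun i hi => ?_, fun i => ?_⟩
  · simp only [s, Fintype.linearCombination_apply]
    exact sum_mem fun k _ => Submodule.smul_mem _ _ (Submodule.subset_span ⟨k, k.2, rfl⟩)
  · have h1 : Submodule.span K (Set.range fun i => s (x i)) = LinearMap.range s := by
      rw [LinearMap.range_eq_map, ← x.span_eq, Submodule.map_span, ← Set.range_comp]
      rfl
    rw [h1]
    exact ⟨Pi.single ⟨i, hi⟩ 1, by simp [s]⟩
  · have h1 : s (N (x i)) ∈ Submodule.span K {y | ∃ k, i < k ∧ y = s (x k)} := by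
      have h2 := Submodule.mem_map_of_mem (f := s) (hx i)
      rw [Submodule.map_span] at h2
      refine Submodule.span_mono ?_ h2
      rintro _ ⟨_, ⟨k, hk, rfl⟩, rfl⟩
      exact ⟨k, hk, rfl⟩
    rw [← add_sub_cancel (s (N (x i))) (A (s (x i)))]
    exact add_mem (Submodule.mem_sup_left h1) (Submodule.mem_sup_right (hNs (x i)))

theorem exists_isTriangular (he : IsAdapted J b e) (hA : Commute A J) (hAn : IsNilpotent A) :
    ∃ e', IsAdapted J b e' ∧ IsTriangular J b e' A := by
  classical
  choose x hx1 hx2 hx3 using fun v (hv : 0 < v) => exists_triangular_class he hA hAn hv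
  let e' : Fin t → V := fun j => if hj : 0 < b j then x (b j) hj ⟨j, rfl⟩ else 0
  have he' : ∀ v hv (j : {j // b j = v}), x v hv j = e' j := by
    rintro _ hv ⟨j, rfl⟩
    simp only [e', dif_pos hv]
  have hspan : ∀ (γ : Fin t → ℕ), (∀ i j, b i = b j → γ i = γ j) →
      tailSpan J e γ ≤ tailSpan J e' γ := by
    intro γ hγ
    rw [tailSpan_le_iff]
    intro j a ha
    by_cases hj : 0 < b j
    · have : Submodule.span K (Set.range (x (b j) hj)) ≤ (tailSpan J e' γ).comap (J ^ a) := by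
        rw [Submodule.span_le]
        rintro _ ⟨k, rfl⟩
        rw [he']
        exact pow_mem_tailSpan ((hγ k j k.2).trans_le ha)
      exact this (hx2 _ hj j rfl)
    · rw [he.pow_eq_zero (by omega)]
      exact zero_mem _
  refine ⟨e', ⟨fun j => ?_, ?_, he.finrank_eq⟩, fun j => ?_⟩
  · by_cases hj : 0 < b j
    · have : Submodule.span K {y | ∃ k, b k = b j ∧ y = e k} ≤ LinearMap.ker (J ^ b j) := by
        rw [Submodule.span_le]
        rintro _ ⟨k, hk, rfl⟩
        exact he.pow_eq_zero hk.le
      rw [← he' _ hj ⟨j, rfl⟩]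
      exact this (hx1 _ hj _)
    · simp [e', hj]
  · have := hspan (fun _ => 0) fun _ _ _ => rfl
    rw [he.tailSpan_zero fun _ => rfl] at this
    simpa [tailSpan] using this
  · by_cases hj : 0 < b j
    · have h1 := hx3 _ hj ⟨j, rfl⟩
      rw [he'] at h1
      refine (?_ : _ ≤ tailSpan J e' (triOff b j)) h1
      refine sup_le ?_ ?_
      · rw [Submodule.span_le]
        rintro _ ⟨k, hk, rfl⟩
        rw [he']
        have : triOff b j k ≤ 0 := by
          have hk2 : b k = b j := k.2
          have hk3 : ¬ (k : Fin t) ≤ j := not_le.2 hk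
          simp [triOff, hk2, hk3]
        exact pow_mem_tailSpan (a := 0) this
      · refine (hspan _ fun i k hik => by simp [valOff, hik]).trans (tailSpan_anti fun i => ?_)
        simp only [triOff, valOff]
        split_ifs <;> omega
    · simp [e', hj]

end Triangular

section Tops

/-- Reading the positive values of `b` downwards, `T` takes a value whenever its successor
has not been taken. -/
def IsTops {ι : Type*} (b : ι → ℕ) (T : Finset ℕ) : Prop :=
  ∀ v, v ∈ T ↔ 0 < v ∧ (∃ j, b j = v) ∧ v + 1 ∉ T

/-- `i` is the first index at which `b` takes a value belonging to `T`. -/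
def IsStart {t : ℕ} (b : Fin t → ℕ) (T : Finset ℕ) (i : Fin t) : Prop :=
  b i ∈ T ∧ ∀ j, b j = b i → i ≤ j

open scoped Classical in
/-- Decrease by one the first occurrence of each value in `T`. -/
noncomputable def delTops {t : ℕ} (b : Fin t → ℕ) (T : Finset ℕ) (i : Fin t) : ℕ :=
  b i - if IsStart b T i then 1 else 0

theorem exists_isTops {ι : Type*} [Fintype ι] (b : ι → ℕ) : ∃ T, IsTops b T := by
  classical
  set B := ∑ j, b j
  have hb : ∀ j, b j ≤ B := fun j =>
    Finset.single_le_sum (f := b) (fun _ _ => Nat.zero_le _) (Finset.mem_univ j)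
  have key : ∀ n, ∃ T : Finset ℕ, (∀ v ∈ T, B < v + n) ∧
      ∀ v, B < v + n → (v ∈ T ↔ 0 < v ∧ (∃ j, b j = v) ∧ v + 1 ∉ T) := by
    intro n
    induction n with
    | zero =>
      refine ⟨∅, by simp, fun v hv => ?_⟩
      simp only [Finset.notMem_empty, not_false_eq_true, and_true, false_iff]
      rintro ⟨-, j, rfl⟩
      have := hb j
      omega
    | succ n ih =>
      obtain ⟨T, h1, h2⟩ := ih
      by_cases hc : n ≤ B ∧ 0 < B - n ∧ (∃ j, b j = B - n) ∧ B - n + 1 ∉ T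
      · refine ⟨insert (B - n) T, fun v hv => ?_, fun v hv => ?_⟩
        · rcases Finset.mem_insert.1 hv with rfl | hv
          · omega
          · have := h1 v hv
            omega
        · by_cases hvB : v = B - n
          · subst hvB
            simp only [Finset.mem_insert, true_or, true_iff, not_or]
            exact ⟨hc.2.1, hc.2.2.1, by omega, hc.2.2.2⟩
          · rw [Finset.mem_insert, Finset.mem_insert, h2 v (by omega)]
            have : v + 1 ≠ B - n := by omega
            simp [hvB, this]
      · refine ⟨T, fun v hv => by have := h1 v hv; omega, fun v hv => ?_⟩
        by_cases hvB : v + n = B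
        · obtain rfl : v = B - n := by omega
          refine ⟨fun h => ?_, fun h => absurd ⟨by omega, h⟩ hc⟩
          have := h1 _ h
          omega
        · exact h2 v (by omega)
  obtain ⟨T, h1, h2⟩ := key (B + 1)
  exact ⟨T, fun v => h2 v (by omega)⟩

theorem exists_isStart {t : ℕ} {b : Fin t → ℕ} {T : Finset ℕ} (hT : IsTops b T) {v : ℕ}
    (hv : v ∈ T) : ∃ i, IsStart b T i ∧ b i = v := by
  classical
  obtain ⟨j, hj⟩ := ((hT v).1 hv).2.1
  have hne : (Finset.univ.filter fun i => b i = v).Nonempty := ⟨j, by simpa using hj⟩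
  have h1 := Finset.min'_mem _ hne
  simp only [Finset.mem_filter, Finset.mem_univ, true_and] at h1
  exact ⟨_, ⟨h1.symm ▸ hv, fun k hk => Finset.min'_le _ _ (by simp [hk, h1])⟩, h1⟩

open scoped Classical in
theorem card_isStart {t : ℕ} {b : Fin t → ℕ} {T : Finset ℕ} (hT : IsTops b T) (p : ℕ → Prop)
    [DecidablePred p] :
    (Finset.univ.filter fun i => IsStart b T i ∧ p (b i)).card = (T.filter p).card := by
  refine Finset.card_bij (fun i _ => b i) (fun i hi => ?_) (fun i hi j hj hij => ?_) fun v hv => ?_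
  · simp only [Finset.mem_filter, Finset.mem_univ, true_and] at hi ⊢
    exact ⟨hi.1.1, hi.2⟩
  · simp only [Finset.mem_filter, Finset.mem_univ, true_and] at hi hj
    exact le_antisymm (hi.1.2 j hij.symm) (hj.1.2 i hij)
  · rw [Finset.mem_filter] at hv
    obtain ⟨i, hi, rfl⟩ := exists_isStart hT hv.1
    exact ⟨i, by simp [hi, hv.2], rfl⟩

open scoped Classical in
theorem sum_sub_start {t : ℕ} (b α : Fin t → ℕ) (T : Finset ℕ) (b' : Fin t → ℕ) :
    ∑ j, (b' j - (α j + if IsStart b T j then 1 else 0)) +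
      (Finset.univ.filter fun j => IsStart b T j ∧ α j < b' j).card = ∑ j, (b' j - α j) := by
  rw [Finset.card_filter, ← Finset.sum_add_distrib]
  refine Finset.sum_congr rfl fun j _ => ?_
  by_cases h : IsStart b T j <;> by_cases h' : α j < b' j <;> simp [h, h'] <;> omega

open scoped Classical in
theorem sum_delTops {t : ℕ} {b : Fin t → ℕ} {T : Finset ℕ} (hT : IsTops b T) (s : ℕ) :
    ∑ j, (delTops b T j - s) + (T.filter (s < ·)).card = ∑ j, (b j - s) := by
  rw [← card_isStart hT, ← sum_sub_start b (fun _ => s) T b]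
  congr 1
  refine Finset.sum_congr rfl fun j _ => ?_
  simp only [delTops]
  omega

theorem card_filter_lt_succ (T : Finset ℕ) (i y : ℕ) :
    (T.filter fun v => i < v ∧ v < y + 1).card =
      (T.filter fun v => i < v ∧ v < y).card + if y ∈ T ∧ i < y then 1 else 0 := by
  by_cases h : y ∈ T ∧ i < y
  · rw [if_pos h, ← Finset.card_insert_of_notMem (a := y) (by simp)]
    congr 1
    ext v
    simp only [Finset.mem_filter, Finset.mem_insert]
    constructor
    · rintro ⟨h1, h2, h3⟩
      by_cases hv : v = y
      · exact .inl hv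
      · exact .inr ⟨h1, h2, by omega⟩
    · rintro (rfl | ⟨h1, h2, h3⟩)
      · exact ⟨h.1, h.2, by omega⟩
      · exact ⟨h1, h2, by omega⟩
  · rw [if_neg h, add_zero]
    congr 1
    ext v
    simp only [Finset.mem_filter]
    constructor
    · rintro ⟨h1, h2, h3⟩
      refine ⟨h1, h2, lt_of_le_of_ne (by omega) ?_⟩
      rintro rfl
      exact h ⟨h1, h2⟩
    · rintro ⟨h1, h2, h3⟩
      exact ⟨h1, h2, by omega⟩

theorem card_filter_lt_add {ι : Type*} {b : ι → ℕ} {T : Finset ℕ} (hT : IsTops b T) (i x k : ℕ)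
    (hk : 0 < k) :
    (T.filter fun v => i < v ∧ v < x + k + 1).card ≤
      (T.filter fun v => i < v ∧ v < x).card + k := by
  induction k, hk using Nat.le_induction with
  | base =>
    rw [card_filter_lt_succ, card_filter_lt_succ]
    by_cases h : x ∈ T
    · have : x + 1 ∉ T := ((hT x).1 h).2.2
      simp only [this, false_and, if_false]
      split_ifs <;> omega
    · simp only [h, false_and, if_false]
      split_ifs <;> omega
  | succ k _ ih =>
    rw [card_filter_lt_succ, ← add_assoc]
    split_ifs <;> omega

theorem finrank_map_add_finrank_ker_inf {K V W : Type*} [Field K] [AddCommGroup V] [Module K V]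
    [FiniteDimensional K V] [AddCommGroup W] [Module K W] (A : V →ₗ[K] W) (Y : Submodule K V) :
    Module.finrank K (Y.map A) + Module.finrank K (LinearMap.ker A ⊓ Y : Submodule K V) =
      Module.finrank K Y := by
  have h1 := LinearMap.finrank_range_add_finrank_ker (A.domRestrict Y)
  rw [LinearMap.range_domRestrict, LinearMap.ker_domRestrict] at h1
  rw [← h1]
  congr 1
  rw [inf_comm, ← Submodule.map_comap_subtype, Submodule.finrank_map_subtype_eq]

theorem finrank_map_add_finrank_le {K V W : Type*} [Field K] [AddCommGroup V] [Module K V]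
    [FiniteDimensional K V] [AddCommGroup W] [Module K W] (A : V →ₗ[K] W) {F X : Submodule K V}
    (h : F ≤ X) : Module.finrank K (X.map A) + Module.finrank K F ≤
      Module.finrank K (F.map A) + Module.finrank K X := by
  have h1 := finrank_map_add_finrank_ker_inf A F
  have h2 := finrank_map_add_finrank_ker_inf A X
  have := Submodule.finrank_mono (inf_le_inf_left (LinearMap.ker A) h)
  omega

variable {K V : Type*} [Field K] [AddCommGroup V] [Module K V] [FiniteDimensional K V]
  {J A M : Module.End K V} {t : ℕ} {b : Fin t → ℕ} {e : Fin t → V} {T : Finset ℕ}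

open scoped Classical in
theorem IsTriangular.finrank_range_le (he : IsAdapted J b e) (hA : Commute A J)
    (hU : IsTriangular J b e A) (hT : IsTops b T) (i : ℕ) :
    Module.finrank K (LinearMap.range (A * J ^ i)) + (T.filter (i < ·)).card ≤
      ∑ j, (b j - i) := by
  set c : ℕ → ℕ := fun x => (T.filter fun v => i < v ∧ v < x).card with hc
  set α : Fin t → ℕ := fun j => i + c (b j) with hα
  set γ : Fin t → ℕ := fun j => α j + if IsStart b T j ∧ i < b j then 1 else 0 with hγ
  have hcx : ∀ x, i < x → i + c x < x := by
    intro x hx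
    have : (T.filter fun v => i < v ∧ v < x) ⊆ Finset.Ioo i x := fun v hv => by
      simpa using (Finset.mem_filter.1 hv).2
    have := Finset.card_le_card this
    rw [Nat.card_Ioo] at this
    simp only [hc]
    omega
  have hmap : (tailSpan J e α).map A ≤ tailSpan J e γ := by
    refine map_tailSpan_le hA hU fun j k => ?_
    have h1 := card_filter_lt_succ T i (b k)
    have hstart : (if IsStart b T k ∧ i < b k then 1 else 0) ≤
        if b k ∈ T ∧ i < b k then 1 else 0 := by
      split_ifs with h2 h3 <;> first | omega | exact absurd ⟨h2.1.1, h2.2⟩ h3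
    simp only [hγ, hα, triOff, hc]
    rcases lt_trichotomy (b k) (b j) with h | h | h
    · have : (T.filter fun v => i < v ∧ v < b k + 1).card ≤
          (T.filter fun v => i < v ∧ v < b j).card :=
        Finset.card_le_card (Finset.monotone_filter_right _ fun v _ hv => ⟨hv.1, by omega⟩)
      omega
    · have : (if IsStart b T k ∧ i < b k then 1 else 0) ≤ if b k = b j ∧ k ≤ j then 1 else 0 := by
        split_ifs with h2 h3 <;> first | omega | exact absurd ⟨h, h2.1.2 j h.symm⟩ h3
      rw [h] at this ⊢
      omega
    · obtain ⟨d, hd, hd'⟩ : ∃ d, 0 < d ∧ b k = b j + d := ⟨b k - b j, by omega, by omega⟩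
      have := card_filter_lt_add hT i (b j) d hd
      rw [← hd'] at this
      omega
  have h1 : LinearMap.range (A * J ^ i) = (tailSpan J e fun _ => i).map A := by
    rw [← he.range_pow, Module.End.mul_eq_comp, LinearMap.range_comp]
  have h2 := finrank_map_add_finrank_le A
    (tailSpan_anti (J := J) (e := e) (α := fun _ => i) (β := α) fun j => by simp [hα])
  have h3 := Submodule.finrank_mono hmap
  rw [← h1, he.finrank_tailSpan, he.finrank_tailSpan] at h2
  rw [he.finrank_tailSpan] at h3
  have h4 : ∑ j, (b j - γ j) + (T.filter (i < ·)).card = ∑ j, (b j - α j) := by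
    rw [← card_isStart hT, Finset.card_filter, ← Finset.sum_add_distrib]
    refine Finset.sum_congr rfl fun j _ => ?_
    simp only [hγ]
    split_ifs with h
    · have := hcx _ h.2
      simp only [hα]
      omega
    · simp
  omega

theorem exists_model (hb : Antitone b) (hpos : ∀ j, 0 < b j) (hT : IsTops b T) :
    ∃ μ : Fin t → ℕ × Fin t, (∀ j, triOff b j (μ j).2 ≤ (μ j).1) ∧
      (∀ i, ¬ IsStart b T i → ∃ j, μ j = (0, i)) ∧ ∀ i, ∃ j, (μ j).1 ≤ 1 ∧ (μ j).2 = i := by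
  classical
  have hle : ∀ j, ∃ i, i ≤ j ∧ IsStart b T i ∧ b i ≤ b j + 1 := by
    intro j
    by_cases hj : b j ∈ T
    · obtain ⟨i, hi, hij⟩ := exists_isStart hT hj
      exact ⟨i, hi.2 j hij.symm, hi, by omega⟩
    · have : b j + 1 ∈ T := by
        by_contra h
        exact hj ((hT _).2 ⟨hpos j, ⟨j, rfl⟩, h⟩)
      obtain ⟨i, hi, hij⟩ := exists_isStart hT this
      refine ⟨i, le_of_not_gt fun h => ?_, hi, by omega⟩
      have := hb h.le
      omega
  have hσ : ∀ j, ∃ i, (i ≤ j ∧ IsStart b T i) ∧ ∀ k, k ≤ j → IsStart b T k → k ≤ i := by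
    intro j
    have hne : (Finset.univ.filter fun i => i ≤ j ∧ IsStart b T i).Nonempty := by
      obtain ⟨i, h1, h2, -⟩ := hle j
      exact ⟨i, by simp [h1, h2]⟩
    have h1 := Finset.max'_mem _ hne
    rw [Finset.mem_filter] at h1
    exact ⟨_, h1.2, fun k hk hk' => Finset.le_max' _ _ (by simp [hk, hk'])⟩
  choose σ hσ1 hσ2 using hσ
  let μ : Fin t → ℕ × Fin t := fun j =>
    if h : ∃ h : (j : ℕ) + 1 < t, ¬ IsStart b T ⟨j + 1, h⟩ then (0, ⟨j + 1, h.1⟩) else (1, σ j)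
  have hns : ∀ i, ¬ IsStart b T i → ∃ j, μ j = (0, i) := by
    intro i hi
    have hi0 : (i : ℕ) ≠ 0 := by
      intro h
      have := hσ1 i
      have h2 : σ i = i := Fin.ext (by have : (σ i : ℕ) ≤ i := this.1; omega)
      exact hi (h2 ▸ this.2)
    have h1 : (⟨(i : ℕ) - 1 + 1, by omega⟩ : Fin t) = i := Fin.ext (by simp only; omega)
    refine ⟨⟨i - 1, by omega⟩, ?_⟩
    have h2 : ∃ h : (i : ℕ) - 1 + 1 < t, ¬ IsStart b T ⟨i - 1 + 1, h⟩ := ⟨by omega, by rwa [h1]⟩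
    simp only [μ, dif_pos h2, h1]
  refine ⟨μ, fun j => ?_, hns, fun i => ?_⟩
  · by_cases h : ∃ h : (j : ℕ) + 1 < t, ¬ IsStart b T ⟨j + 1, h⟩
    · simp only [μ, dif_pos h, triOff]
      have h1 : j < ⟨j + 1, h.1⟩ := Fin.lt_def.2 (by simp)
      have := hb h1.le
      rw [if_neg fun h' => absurd h'.2 (not_le.2 h1)]
      omega
    · simp only [μ, dif_neg h, triOff]
      obtain ⟨i, h1, h2, h3⟩ := hle j
      have := hb (hσ2 j i h1 h2)
      split_ifs <;> omega
  · by_cases hi : IsStart b T i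
    · have hne : (Finset.univ.filter fun j => i ≤ j ∧ ∀ k, i < k → k ≤ j →
          ¬ IsStart b T k).Nonempty :=
        ⟨i, by simpa using fun k h1 h2 => absurd h1 (not_lt.2 h2)⟩
      have h1 := Finset.max'_mem _ hne
      set j := Finset.max' _ hne
      simp only [Finset.mem_filter, Finset.mem_univ, true_and] at h1
      have h2 : ¬ ∃ h : (j : ℕ) + 1 < t, ¬ IsStart b T ⟨j + 1, h⟩ := by
        rintro ⟨h, hs⟩
        have : (⟨j + 1, h⟩ : Fin t) ≤ j := by
          refine Finset.le_max' _ _ ?_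
          simp only [Finset.mem_filter, Finset.mem_univ, true_and]
          refine ⟨h1.1.trans (Fin.le_def.2 (by simp)), fun k hk hk' => ?_⟩
          rcases hk'.eq_or_lt with rfl | hlt
          · exact hs
          · exact h1.2 k hk (Fin.le_def.2 (by have := Fin.lt_def.1 hlt; simp at this; omega))
        have := Fin.le_def.1 this
        simp at this
      refine ⟨j, by simp [μ, dif_neg h2], ?_⟩
      simp only [μ, dif_neg h2]
      refine le_antisymm (le_of_not_gt fun h => ?_) (hσ2 j i h1.1 hi)
      exact h1.2 _ h (hσ1 j).1 (hσ1 j).2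
    · obtain ⟨j, hj⟩ := hns i hi
      exact ⟨j, by simp [hj], by simp [hj]⟩

open scoped Classical in
theorem le_finrank_range_model {b' : Fin t → ℕ} (he : IsAdapted J b' e) (hM : Commute M J)
    {μ : Fin t → ℕ × Fin t} (hμ : ∀ i, ¬ IsStart b T i → ∃ j, μ j = (0, i))
    (hμ' : ∀ i, ∃ j, (μ j).1 ≤ 1 ∧ (μ j).2 = i) (hMe : ∀ j, M (e j) = (J ^ (μ j).1) (e (μ j).2))
    (s : ℕ) : ∑ j, (b' j - s) ≤ Module.finrank K (LinearMap.range (M * J ^ s)) +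
      (Finset.univ.filter fun i => IsStart b T i ∧ s < b' i).card := by
  rw [← sum_sub_start b (fun _ => s) T b', ← he.finrank_tailSpan]
  refine Nat.add_le_add_right (Submodule.finrank_mono ?_) _
  rw [tailSpan_le_iff]
  have key : ∀ j a, (M * J ^ s) ((J ^ a) (e j)) = (J ^ (a + s + (μ j).1)) (e (μ j).2) := by
    intro j a
    rw [← Module.End.mul_apply, mul_assoc, ← pow_add, (hM.pow_right _).eq, Module.End.mul_apply,
      hMe, ← Module.End.mul_apply, ← pow_add, add_comm s a]
  intro i a ha
  by_cases hi : IsStart b T i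
  · rw [if_pos hi] at ha
    obtain ⟨j, hj, rfl⟩ := hμ' i
    refine ⟨(J ^ (a - s - (μ j).1)) (e j), ?_⟩
    rw [key]
    congr 2
    omega
  · rw [if_neg hi] at ha
    obtain ⟨j, hj⟩ := hμ i hi
    refine ⟨(J ^ (a - s)) (e j), ?_⟩
    rw [key, hj]
    congr 2
    simp only
    omega

end Tops

section Pencil

variable {K V : Type*} [Field K] [AddCommGroup V] [Module K V] [FiniteDimensional K V]

open Polynomial in
theorem finite_setOf_finrank_range_lt (P A M : Module.End K V) (m : ℕ) :
    {ε : K | Module.finrank K (LinearMap.range ((A + ε • M) ^ m * P)) <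
      Module.finrank K (LinearMap.range (A ^ m * P))}.Finite := by
  classical
  set f := A ^ m * P
  set r := Module.finrank K (LinearMap.range f)
  let g : LinearMap.range f ≃ₗ[K] (Fin r → K) := LinearEquiv.ofFinrankEq _ _ (by simp [r])
  obtain ⟨s, hs⟩ := f.rangeRestrict.exists_rightInverse_of_surjective f.range_rangeRestrict
  obtain ⟨q, hq⟩ := (LinearMap.range f).subtype.exists_leftInverse_of_injective
    (LinearMap.range f).ker_subtype
  let L : (Fin r → K) →ₗ[K] V := s ∘ₗ g.symm.toLinearMap
  let R : V →ₗ[K] (Fin r → K) := g.toLinearMap ∘ₗ q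
  have hRL : R ∘ₗ f ∘ₗ L = LinearMap.id := by
    refine LinearMap.ext fun x => ?_
    have h1 : f (s (g.symm x)) = (g.symm x : V) :=
      congrArg Subtype.val (LinearMap.congr_fun hs (g.symm x))
    have h2 : q (g.symm x : V) = g.symm x := LinearMap.congr_fun hq (g.symm x)
    simp [R, L, h1, h2]
  let B := Module.finBasis K V
  let S := Pi.basisFun K (Fin r)
  let p : K[X] := Matrix.det ((LinearMap.toMatrix B S R).map C *
    ((((LinearMap.toMatrix B B A).map C + (X : K[X]) • (LinearMap.toMatrix B B M).map C) ^ m) *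
      (LinearMap.toMatrix B B P).map C) * (LinearMap.toMatrix S B L).map C)
  have hp : ∀ ε, p.eval ε = LinearMap.det (R ∘ₗ ((A + ε • M) ^ m * P) ∘ₗ L) := by
    intro ε
    have hC : ∀ {k l : Type} (Q : Matrix k l K), (Q.map C).map (evalRingHom ε) = Q := fun Q => by
      ext; simp
    rw [← LinearMap.det_toMatrix S, LinearMap.toMatrix_comp S B S, LinearMap.toMatrix_comp S B B,
      LinearMap.toMatrix_mul, ← LinearMap.toMatrix_pow, map_add, map_smul, ← Matrix.mul_assoc]
    change evalRingHom ε p = _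
    rw [RingHom.map_det, RingHom.mapMatrix_apply, Matrix.map_mul, Matrix.map_mul, Matrix.map_mul,
      hC, hC, hC, ← RingHom.mapMatrix_apply _ (_ ^ m), map_pow, map_add, RingHom.mapMatrix_apply, hC,
      RingHom.mapMatrix_apply, Matrix.map_smul' _ _ _ (map_mul _), hC, coe_evalRingHom, eval_X]
  have hp0 : p ≠ 0 := by
    intro h
    have := hp 0
    rw [h] at this
    simp only [eval_zero, zero_smul, add_zero] at this
    change _ = LinearMap.det (R ∘ₗ f ∘ₗ L) at this
    rw [hRL] at this
    simp at this
  refine (p.rootSet_finite K).subset fun ε hε => ?_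
  rw [Polynomial.mem_rootSet]
  refine ⟨hp0, ?_⟩
  rw [Polynomial.coe_aeval_eq_eval, hp]
  by_contra hdet
  rw [Set.mem_ofPred_eq, ← not_le] at hε
  refine hε ?_
  have hu : IsUnit (R ∘ₗ ((A + ε • M) ^ m * P) ∘ₗ L) :=
    (LinearMap.isUnit_iff_isUnit_det _).2 (isUnit_iff_ne_zero.2 hdet)
  have hsurj : LinearMap.range (R ∘ₗ ((A + ε • M) ^ m * P) ∘ₗ L) = ⊤ :=
    (LinearMap.isUnit_iff_range_eq_top _).1 hu
  have h1 : r = Module.finrank K (LinearMap.range (R ∘ₗ ((A + ε • M) ^ m * P) ∘ₗ L)) := by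
    rw [hsurj, finrank_top]
    simp
  change r ≤ _
  rw [h1, LinearMap.range_comp]
  exact (Submodule.finrank_map_le _ _).trans
    (Submodule.finrank_mono (LinearMap.range_comp_le_range _ _))

theorem finite_setOf_finrank_range_lt' (P A M : Module.End K V) (m : ℕ) :
    {ε : K | Module.finrank K (LinearMap.range ((A + ε • M) ^ m * P)) <
      Module.finrank K (LinearMap.range (M ^ m * P))}.Finite := by
  refine (((finite_setOf_finrank_range_lt P M A m).image (·⁻¹)).insert 0).subset fun ε hε => ?_
  by_cases h0 : ε = 0
  · exact .inl h0
  · refine .inr ⟨ε⁻¹, ?_, inv_inv ε⟩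
    have : A + ε • M = ε • (M + ε⁻¹ • A) := by
      rw [smul_add, smul_inv_smul₀ h0, add_comm]
    rw [Set.mem_ofPred_eq, this, smul_pow, smul_mul_assoc, LinearMap.range_smul _ _ (pow_ne_zero m h0)]
      at hε
    exact hε

end Pencil

section Restrict

variable {K V W : Type*} [Field K] [AddCommGroup V] [Module K V]
  [AddCommGroup W] [Module K W] [FiniteDimensional K W] {J A : Module.End K V}
  {J' : Module.End K W}

theorem finrank_range_restrict_pow {f : Module.End K V} {p : Submodule K V}
    (h : ∀ x ∈ p, f x ∈ p) (k : ℕ) :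
    Module.finrank K (LinearMap.range ((f.restrict h) ^ k)) = Module.finrank K (p.map (f ^ k)) := by
  rw [Module.End.pow_restrict, ← Submodule.finrank_map_subtype_eq p, ← LinearMap.range_comp,
    LinearMap.subtype_comp_restrict, LinearMap.range_domRestrict]

variable [FiniteDimensional K V]

theorem exists_commute_of_map_pow_eq {κ : Type*} [Fintype κ] {c : κ → ℕ} {f : κ → W}
    (hf : IsAdapted J' c f) (hJ : IsNilpotent J) (hA : Commute A J) (hAn : IsNilpotent A)
    {p : Submodule K V} (hpJ : ∀ x ∈ p, J x ∈ p) (hpA : ∀ x ∈ p, A x ∈ p)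
    (hp : ∀ i, Module.finrank K (p.map (J ^ i)) = ∑ j, (c j - i)) :
    ∃ A' : Module.End K W, Commute A' J' ∧ IsNilpotent A' ∧
      ∀ m, Module.finrank K (LinearMap.range (A' ^ m)) = Module.finrank K (p.map (A ^ m)) := by
  have hnil : ∀ (B : Module.End K V) (h : ∀ x ∈ p, B x ∈ p), IsNilpotent B →
      IsNilpotent (B.restrict h) := by
    rintro B h ⟨k, hk⟩
    refine ⟨k, LinearMap.ext fun x => Subtype.ext ?_⟩
    rw [Module.End.pow_restrict]
    simp [hk]
  obtain ⟨e, he⟩ := exists_isAdapted_of_finrank_range (hnil J hpJ hJ)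
    fun i => (finrank_range_restrict_pow hpJ i).trans (hp i)
  obtain ⟨g, hg⟩ := he.exists_linearEquiv hf
  have hg' : ∀ y, g.symm (J' y) = J.restrict hpJ (g.symm y) := fun y => by
    rw [LinearEquiv.symm_apply_eq, hg, LinearEquiv.apply_symm_apply]
  let A' : Module.End K W := g.toLinearMap ∘ₗ A.restrict hpA ∘ₗ g.symm.toLinearMap
  have hpow : ∀ m, A' ^ m = g.toLinearMap ∘ₗ (A.restrict hpA ^ m) ∘ₗ g.symm.toLinearMap := by
    intro m
    induction m with
    | zero => ext; simp
    | succ m ih =>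
      ext x
      rw [pow_succ, pow_succ, ih]
      simp [A']
  refine ⟨A', ?_, ?_, fun m => ?_⟩
  · refine LinearMap.ext fun y => ?_
    simp only [A', Module.End.mul_apply, LinearMap.comp_apply, LinearEquiv.coe_coe, hg', ← hg]
    congr 1
    exact Subtype.ext (LinearMap.congr_fun hA.eq _)
  · obtain ⟨k, hk⟩ := hnil A hpA hAn
    exact ⟨k, by rw [hpow, hk]; simp⟩
  · rw [hpow, ← finrank_range_restrict_pow hpA, LinearMap.range_comp,
      LinearMap.range_comp_of_range_eq_top _ g.symm.range, LinearEquiv.finrank_map_eq]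

end Restrict

section Up

theorem IsTops.of_sum_eq {ι κ : Type*} [Fintype ι] [Fintype κ] {b : ι → ℕ} {k : κ → ℕ}
    {T : Finset ℕ} (hT : IsTops b T) (h : ∀ s, ∑ j, (b j - s) = ∑ j, (k j - s)) : IsTops k T := by
  intro v
  rw [hT v]
  refine and_congr_right fun hv => and_congr_left fun _ => ?_
  have := card_eq_of_sum_sub_eq h hv
  have h1 : Nonempty {j // b j = v} ↔ Nonempty {j // k j = v} := by
    rw [← Fintype.card_pos_iff, ← Fintype.card_pos_iff, this]
  simpa [nonempty_subtype] using h1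

variable {K V W : Type*} [Field K] [AddCommGroup V] [Module K V]
  [AddCommGroup W] [Module K W] [FiniteDimensional K W]
  {J A M : Module.End K V} {J' : Module.End K W}

theorem IsTriangular.add_smul {t : ℕ} {b : Fin t → ℕ} {e : Fin t → V} (hA : IsTriangular J b e A)
    (hM : IsTriangular J b e M) (ε : K) : IsTriangular J b e (A + ε • M) :=
  fun j => add_mem (hA j) (Submodule.smul_mem _ _ (hM j))

variable [FiniteDimensional K V]

theorem IsAdapted.exists_commute {ι : Type*} [Fintype ι] {b : ι → ℕ} {e : ι → V}
    (he : IsAdapted J b e) (u : ι → V) (hu : ∀ j, (J ^ b j) (u j) = 0) :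
    ∃ M : Module.End K V, Commute M J ∧ ∀ j, M (e j) = u j := by
  obtain ⟨M, hM, hMe⟩ := he.exists_lift J u hu
  exact ⟨M, LinearMap.ext hM, hMe⟩

variable [Infinite K]

theorem exists_le_finrank_range_pow_succ {ι κ : Type*} [Fintype ι] [Fintype κ] {b : ι → ℕ}
    {e : ι → V} (he : IsAdapted J b e) {c : κ → ℕ} {f : κ → W} (hf : IsAdapted J' c f)
    {T : Finset ℕ} (hT : IsTops b T)
    (hc : ∀ s, ∑ j, (c j - s) + (T.filter (s < ·)).card = ∑ j, (b j - s))
    (hA : Commute A J) (hAn : IsNilpotent A) (m : ℕ) :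
    ∃ A' : Module.End K W, Commute A' J' ∧ IsNilpotent A' ∧
      Module.finrank K (LinearMap.range (A ^ (m + 1))) ≤
        Module.finrank K (LinearMap.range (A' ^ m)) := by
  obtain ⟨t, b', hb', hpos, hbb⟩ := exists_antitone_pos b
  obtain ⟨e', he'⟩ := he.exists_of_sum_eq hbb
  obtain ⟨x, hx, hU⟩ := exists_isTriangular he' hA hAn
  have hT' := hT.of_sum_eq fun s => (hbb s).symm
  obtain ⟨μ, hμ1, hμ2, hμ3⟩ := exists_model hb' hpos hT'
  obtain ⟨M, hM, hMx⟩ := hx.exists_commute (fun j => (J ^ (μ j).1) (x (μ j).2)) fun j => by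
    rw [← Module.End.mul_apply, ← pow_add]
    refine hx.pow_eq_zero ?_
    have := hμ1 j
    simp only [triOff] at this
    omega
  have hMU : IsTriangular J b' x M := fun j => by
    rw [hMx]
    exact pow_mem_tailSpan (hμ1 j)
  set B := ∑ j, b' j
  obtain ⟨ε, hε⟩ := (((finite_setOf_finrank_range_lt 1 A M (m + 1)).union
    ((Finset.range B).finite_toSet.biUnion fun i _ =>
      finite_setOf_finrank_range_lt' (J ^ i) A M 1))).infinite_compl.nonempty
  simp only [Set.mem_compl_iff, Set.mem_union, Set.mem_iUnion, not_or, not_exists,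
    Set.mem_ofPred_eq, not_lt, Finset.coe_range, Set.mem_Iio] at hε
  set D := A + ε • M with hD
  have hε1 := hε.1
  rw [mul_one, mul_one] at hε1
  have hε2 : ∀ i < B, Module.finrank K (LinearMap.range (M * J ^ i)) ≤
      Module.finrank K (LinearMap.range (D * J ^ i)) := fun i hi => by
    have := hε.2 i hi
    rwa [pow_one, pow_one] at this
  have hDJ : Commute D J := hA.add_left (hM.smul_left ε)
  have hDU : IsTriangular J b' x D := hU.add_smul hMU ε
  have hDn := hDU.isNilpotent hx hDJ
  obtain ⟨A', h1, h2, h3⟩ := exists_commute_of_map_pow_eq (p := LinearMap.range D) hf hx.isNilpotent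
    hDJ hDn (by
      rintro _ ⟨y, rfl⟩
      exact ⟨J y, LinearMap.congr_fun hDJ.eq y⟩) (fun y _ => ⟨y, rfl⟩) fun i => by
      rw [← LinearMap.range_comp, ← Module.End.mul_eq_comp, ← (hDJ.pow_right i).eq]
      have h4 := hDU.finrank_range_le hx hDJ hT' i
      rw [hbb, ← hc] at h4
      refine le_antisymm (by omega) ?_
      by_cases hi : i < B
      · refine le_trans ?_ (hε2 i hi)
        have h5 := le_finrank_range_model hx hM hμ2 hμ3 hMx i
        rw [card_isStart hT' (i < ·), hbb, ← hc] at h5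
        omega
      · have h5 : ∑ j, (b' j - i) = 0 := Finset.sum_eq_zero fun j _ => by
          have : b' j ≤ B := Finset.single_le_sum (fun _ _ => Nat.zero_le _) (Finset.mem_univ j)
          omega
        rw [hbb, ← hc] at h5
        omega
  refine ⟨A', h1, h2, hε1.trans ?_⟩
  rw [h3, ← LinearMap.range_comp, ← Module.End.mul_eq_comp, ← pow_succ]

end Up

section Down

theorem IsTops.complement {t : ℕ} {b : Fin t → ℕ} {T : Finset ℕ} (hT : IsTops b T)
    (hpos : ∀ j, 0 < b j) {N : ℕ} (hN : ∀ j, b j ≤ N) (σ : Equiv.Perm (Fin t)) :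
    IsTops (fun j => N - delTops b T (σ j)) (T.image (N + 1 - ·)) := by
  classical
  have hTN : ∀ v ∈ T, 0 < v ∧ v ≤ N := fun v hv => by
    obtain ⟨h1, ⟨j, rfl⟩, -⟩ := (hT v).1 hv
    exact ⟨h1, hN j⟩
  have hmem : ∀ u, u ∈ T.image (N + 1 - ·) ↔ u ≤ N + 1 ∧ N + 1 - u ∈ T := by
    intro u
    rw [Finset.mem_image]
    constructor
    · rintro ⟨v, hv, rfl⟩
      have := hTN v hv
      exact ⟨by omega, by rwa [show N + 1 - (N + 1 - v) = v by omega]⟩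
    · rintro ⟨h, h'⟩
      exact ⟨_, h', by omega⟩
  intro u
  rw [hmem, hmem]
  constructor
  · rintro ⟨h1, h2⟩
    have h3 := hTN _ h2
    refine ⟨by omega, ?_, ?_⟩
    · obtain ⟨i, hi, hi'⟩ := exists_isStart hT h2
      refine ⟨σ.symm i, ?_⟩
      simp only [Equiv.apply_symm_apply, delTops, if_pos hi]
      omega
    · rintro ⟨h4, h5⟩
      refine ((hT _).1 h5).2.2 ?_
      rwa [show N + 1 - (u + 1) + 1 = N + 1 - u by omega]
  · rintro ⟨h1, ⟨j, hj⟩, h2⟩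
    have h3 := hpos (σ j)
    have h4 := hN (σ j)
    simp only [delTops] at hj
    split_ifs at hj with hs
    · refine ⟨by omega, ?_⟩
      rw [show N + 1 - u = b (σ j) by omega]
      exact hs.1
    · refine ⟨by omega, ?_⟩
      by_contra h5
      refine h2 ⟨by omega, (hT _).2 ⟨by omega, ⟨σ j, by omega⟩, ?_⟩⟩
      rwa [show N + 1 - (u + 1) + 1 = N + 1 - u by omega]

variable {K V W : Type*} [Field K] [Infinite K] [AddCommGroup V] [Module K V]
  [FiniteDimensional K V] [AddCommGroup W] [Module K W] [FiniteDimensional K W]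
  {J A M : Module.End K V} {J' : Module.End K W}

theorem exists_finrank_range_pow_le {ι κ : Type*} [Fintype ι] [Fintype κ] {b₀ : ι → ℕ}
    {e₀ : ι → V} (he₀ : IsAdapted J b₀ e₀) {c₀ : κ → ℕ} {f₀ : κ → W} (hf₀ : IsAdapted J' c₀ f₀)
    {T : Finset ℕ} (hT₀ : IsTops b₀ T)
    (hc₀ : ∀ s, ∑ j, (c₀ j - s) + (T.filter (s < ·)).card = ∑ j, (b₀ j - s))
    {A' : Module.End K W} (hA' : Commute A' J') (hAn' : IsNilpotent A') (m : ℕ) :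
    ∃ A : Module.End K V, Commute A J ∧ IsNilpotent A ∧
      Module.finrank K (LinearMap.range (A' ^ m)) ≤
        Module.finrank K (LinearMap.range (A ^ (m + 1))) := by
  classical
  obtain ⟨t, b, hb, hpos, hbb⟩ := exists_antitone_pos b₀
  obtain ⟨x, hx⟩ := he₀.exists_of_sum_eq hbb
  have hT := hT₀.of_sum_eq fun s => (hbb s).symm
  let σ := Tuple.sort (delTops b T)
  set c : Fin t → ℕ := fun j => delTops b T (σ j) with hc
  have hcmono : Monotone c := Tuple.monotone_sort (delTops b T)
  have hcT : ∀ s, ∑ j, (c j - s) + (T.filter (s < ·)).card = ∑ j, (b j - s) := by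
    intro s
    rw [← sum_delTops hT, Equiv.sum_comp σ fun j => delTops b T j - s]
  obtain ⟨f₁, hf₁⟩ := hf₀.exists_of_sum_eq (b := c) fun s => by
    have := hc₀ s
    have := hcT s
    have := hbb s
    omega
  obtain ⟨w, hw, hU'⟩ := exists_isTriangular hf₁ hA' hAn'
  obtain ⟨N, hbN⟩ : ∃ N, ∀ j, b j < N := ⟨∑ j, b j + 1, fun j => Nat.lt_succ_of_le
    (Finset.single_le_sum (f := b) (fun _ _ => Nat.zero_le _) (Finset.mem_univ j))⟩
  have hcN : ∀ j, c j < N := fun j => by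
    have := hbN (σ j)
    simp only [hc, delTops]
    omega
  let z : Fin t → ℕ := fun j => N - c j
  have hz : ∀ j, z j + c j = N := fun j => by have := hcN j; simp only [z]; omega
  have hzanti : Antitone z := fun i j hij => Nat.sub_le_sub_left (hcmono hij) _
  set T' := T.image (N + 1 - ·) with hT'
  have hzT : IsTops z T' := hT.complement hpos (fun j => (hbN j).le) σ
  have hTN : ∀ v ∈ T, 0 < v ∧ v ≤ N := fun v hv => by
    obtain ⟨h1, ⟨j, rfl⟩, -⟩ := (hT v).1 hv
    exact ⟨h1, (hbN j).le⟩
  have hT'card : ∀ i ≤ N, (T'.filter (N - i < ·)).card + (T.filter (i < ·)).card = T.card := by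
    intro i hi
    have h1 : T'.filter (N - i < ·) = (T.filter (¬ i < ·)).image (N + 1 - ·) := by
      rw [hT', Finset.filter_image]
      congr 1
      refine Finset.filter_congr fun v hv => ?_
      have := hTN v hv
      omega
    rw [h1, Finset.card_image_of_injOn, add_comm, Finset.card_filter_add_card_filter_not]
    intro v hv v' hv' hvv
    simp only [Finset.coe_filter, Set.mem_ofPred_eq] at hv hv' hvv
    have := hTN v hv.1
    have := hTN v' hv'.1
    omega
  let E := (Σ _ : Fin t, Fin N) → K
  let Z := (Σ j : Fin t, Fin (z j)) → K
  obtain ⟨JE, e, he⟩ : ∃ (JE : Module.End K E) (e : Fin t → E), IsAdapted JE (fun _ => N) e :=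
    ⟨_, exists_isAdapted_jordanMatrix K fun _ : Fin t => N⟩
  obtain ⟨JZ, g, hg⟩ : ∃ (JZ : Module.End K Z) (g : Fin t → Z), IsAdapted JZ z g :=
    ⟨_, exists_isAdapted_jordanMatrix K z⟩
  have hJN : JE ^ N = 0 := by
    rw [← LinearMap.ker_eq_top, he.ker_pow, he.tailSpan_zero]
    simp
  have hrE : ∀ i, Module.finrank K (LinearMap.range (JE ^ i)) = t * (N - i) := fun i => by
    rw [he.finrank_range_pow]
    simp
  -- the exact sequence `W → E → Z`
  obtain ⟨ι, hι, hιw⟩ := hw.exists_lift JE (fun j => (JE ^ z j) (e j)) fun j => by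
    rw [← Module.End.mul_apply, ← pow_add, add_comm, hz, hJN, LinearMap.zero_apply]
  obtain ⟨q, hq, hqe⟩ := he.exists_lift JZ g fun j =>
    hg.pow_eq_zero (show z j ≤ N by have := hz j; omega)
  have hιpow : ∀ n x, ι ((J' ^ n) x) = (JE ^ n) (ι x) := fun n x => by
    induction n with
    | zero => simp
    | succ n ih => rw [pow_succ', pow_succ', Module.End.mul_apply, Module.End.mul_apply, hι, ih]
  have hqpow : ∀ n x, q ((JE ^ n) x) = (JZ ^ n) (q x) := fun n x => by
    induction n with
    | zero => simp
    | succ n ih => rw [pow_succ', pow_succ', Module.End.mul_apply, Module.End.mul_apply, hq, ih]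
  have hqsurj : LinearMap.range q = ⊤ := by
    rw [eq_top_iff, ← hg.span_eq, Submodule.span_le]
    rintro _ ⟨j, a, rfl⟩
    exact ⟨(JE ^ a) (e j), by rw [hqpow, hqe]⟩
  have hsum : ∑ j, z j + ∑ j, c j = t * N := by
    rw [← Finset.sum_add_distrib, Finset.sum_congr rfl fun j _ => hz j]
    simp
  have hle : LinearMap.range ι ≤ LinearMap.ker q := by
    rw [LinearMap.range_le_ker_iff]
    refine hw.hom_ext (J' := JZ) (fun x => ?_) (by simp) fun j => ?_
    · rw [LinearMap.comp_apply, LinearMap.comp_apply, hι, hq]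
    · rw [LinearMap.comp_apply, hιw, hqpow, hqe, hg.pow_eq, LinearMap.zero_apply]
  have hιrank : ∑ j, c j ≤ Module.finrank K (LinearMap.range ι) := by
    have h1 : tailSpan JE e z ≤ LinearMap.range ι := by
      rw [tailSpan_le_iff]
      intro j a ha
      refine ⟨(J' ^ (a - z j)) (w j), ?_⟩
      rw [hιpow, hιw, ← Module.End.mul_apply, ← pow_add, Nat.sub_add_cancel ha]
    refine le_trans ?_ (Submodule.finrank_mono h1)
    rw [he.finrank_tailSpan]
    exact Finset.sum_le_sum fun j _ => by have := hz j; omega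
  have hex : LinearMap.range ι = LinearMap.ker q := by
    refine Submodule.eq_of_le_of_finrank_le hle ?_
    have h1 := LinearMap.finrank_range_add_finrank_ker q
    have h2 := hrE 0
    rw [hqsurj, finrank_top, hg.finrank_eq, he.finrank_eq] at h1
    simp only [Finset.sum_const, Finset.card_univ, Fintype.card_fin, smul_eq_mul] at h1
    omega
  have hιinj : LinearMap.ker ι = ⊥ := by
    have h1 := LinearMap.finrank_range_add_finrank_ker ι
    rw [hw.finrank_eq] at h1
    exact Submodule.finrank_eq_zero.1 (by omega)
  -- lift the given endomorphism of `W` to `E`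
  have hu : ∀ j, ∃ u ∈ tailSpan JE e (triOff z j), (JE ^ z j) u = ι (A' (w j)) := by
    intro j
    have h1 : tailSpan J' w (triOff c j) ≤
        (tailSpan JE e fun i => triOff z j i + z j).comap ι := by
      rw [tailSpan_le_iff]
      intro i a ha
      rw [Submodule.mem_comap, hιpow, hιw, ← Module.End.mul_apply, ← pow_add]
      refine pow_mem_tailSpan ?_
      have h2 := hz i
      have h3 := hz j
      have h4 : z i = z j ↔ c i = c j := by omega
      simp only [triOff, h4] at ha ⊢
      split_ifs at ha ⊢ <;> omega
    have h2 : ι (A' (w j)) ∈ tailSpan JE e fun i => triOff z j i + z j := h1 (hU' j)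
    rw [← map_pow_tailSpan] at h2
    exact h2
  choose u hu1 hu2 using hu
  obtain ⟨A, hA, hAe⟩ := he.exists_commute u fun j => by rw [hJN, LinearMap.zero_apply]
  obtain ⟨AZ, hAZ, hAg⟩ := hg.exists_commute (fun j => q (u j)) fun j => by
    rw [← hqpow, hu2]
    exact hle ⟨_, rfl⟩
  have hcomm : ∀ {B : Module.End K E}, Commute B JE → ∀ n x, B ((JE ^ n) x) = (JE ^ n) (B x) :=
    fun hB n x => LinearMap.congr_fun (hB.pow_right n).eq x
  have hAι : A ∘ₗ ι = ι ∘ₗ A' := by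
    refine hw.hom_ext (J' := JE) (fun x => ?_) (fun x => ?_) fun j => ?_
    · simpa [hι] using hcomm hA 1 (ι x)
    · rw [LinearMap.comp_apply, LinearMap.comp_apply, ← hι]
      exact congrArg ι (LinearMap.congr_fun hA'.eq x)
    · rw [LinearMap.comp_apply, LinearMap.comp_apply, hιw, hcomm hA, hAe, hu2]
  have hext : ∀ {B : Module.End K E} {BZ : Module.End K Z}, Commute B JE → Commute BZ JZ →
      (∀ j, q (B (e j)) = BZ (g j)) → q ∘ₗ B = BZ ∘ₗ q := by
    intro B BZ hB hBZ h
    refine he.hom_ext (J' := JZ) (fun x => ?_) (fun x => ?_) fun j => ?_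
    · have := hcomm hB 1 x
      rw [pow_one] at this
      rw [LinearMap.comp_apply, LinearMap.comp_apply, this, hq]
    · rw [LinearMap.comp_apply, LinearMap.comp_apply, hq]
      exact LinearMap.congr_fun hBZ.eq _
    · rw [LinearMap.comp_apply, LinearMap.comp_apply, h, hqe]
  have hqA : q ∘ₗ A = AZ ∘ₗ q := hext hA hAZ fun j => by rw [hAe, hAg]
  have hle' : ∀ j, tailSpan JE e (triOff z j) ≤ tailSpan JE e (triOff (fun _ => N) j) := by
    refine fun j => tailSpan_anti fun i => ?_
    simp only [triOff, Nat.sub_self, true_and]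
    by_cases hij : i ≤ j
    · have := hzanti hij
      rw [if_pos hij]
      split_ifs with h <;> omega
    · simp [hij]
  have hAU : IsTriangular JE (fun _ => N) e A := fun j => hle' j (by rw [hAe]; exact hu1 j)
  have hAZU : IsTriangular JZ z g AZ := fun j => by
    rw [hAg]
    have : tailSpan JE e (triOff z j) ≤ (tailSpan JZ g (triOff z j)).comap q := by
      rw [tailSpan_le_iff]
      intro i a ha
      rw [Submodule.mem_comap, hqpow, hqe]
      exact pow_mem_tailSpan ha
    exact this (hu1 j)
  -- the model
  obtain ⟨μ, hμ1, hμ2, hμ3⟩ := exists_model hzanti (fun j => by have := hz j; have := hcN j; omega)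
    hzT
  obtain ⟨M, hM, hMe⟩ := he.exists_commute (fun j => (JE ^ (μ j).1) (e (μ j).2)) fun j => by
    rw [hJN, LinearMap.zero_apply]
  obtain ⟨MZ, hMZ, hMg⟩ := hg.exists_commute (fun j => (JZ ^ (μ j).1) (g (μ j).2)) fun j => by
    rw [← Module.End.mul_apply, ← pow_add]
    refine hg.pow_eq_zero ?_
    have := hμ1 j
    simp only [triOff] at this
    omega
  have hqM : q ∘ₗ M = MZ ∘ₗ q := hext hM hMZ fun j => by rw [hMe, hMg, hqpow, hqe]
  have hMU : IsTriangular JE (fun _ => N) e M := fun j => hle' j (by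
    rw [hMe]
    exact pow_mem_tailSpan (hμ1 j))
  have hMZU : IsTriangular JZ z g MZ := fun j => by
    rw [hMg]
    exact pow_mem_tailSpan (hμ1 j)
  -- a generic member of the pencil
  obtain ⟨ρ, hρ⟩ := (LinearMap.range ι).subtype.exists_leftInverse_of_injective
    (LinearMap.range ι).ker_subtype
  let P : Module.End K E := (LinearMap.range ι).subtype ∘ₗ ρ
  have hP : LinearMap.range P = LinearMap.range ι := by
    refine le_antisymm ?_ fun y hy => ⟨y, congrArg Subtype.val (LinearMap.congr_fun hρ ⟨y, hy⟩)⟩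
    rintro _ ⟨y, rfl⟩
    exact (ρ y).2
  obtain ⟨ε, hε⟩ := (((finite_setOf_finrank_range_lt P A M m).union
    (finite_setOf_finrank_range_lt' 1 A M 1)).union
    ((Finset.range (N + 1)).finite_toSet.biUnion fun i _ =>
      finite_setOf_finrank_range_lt' (JZ ^ i) AZ MZ 1)).infinite_compl.nonempty
  simp only [Set.mem_compl_iff, Set.mem_union, Set.mem_iUnion, not_or, not_exists,
    Set.mem_ofPred_eq, not_lt, Finset.coe_range, Set.mem_Iio] at hε
  obtain ⟨⟨hε1, hε2⟩, hε3⟩ := hε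
  rw [pow_one, pow_one, mul_one, mul_one] at hε2
  set D : Module.End K E := A + ε • M with hD
  set DZ : Module.End K Z := AZ + ε • MZ with hDZ
  have hDc : Commute D JE := hA.add_left (hM.smul_left ε)
  have hDZc : Commute DZ JZ := hAZ.add_left (hMZ.smul_left ε)
  have hDn : IsNilpotent D := (hAU.add_smul hMU ε).isNilpotent he hDc
  have hqD : ∀ x, q (D x) = DZ (q x) := fun x => by
    have h1 := LinearMap.congr_fun hqA x
    have h2 := LinearMap.congr_fun hqM x
    rw [LinearMap.comp_apply, LinearMap.comp_apply] at h1 h2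
    simp [hD, hDZ, h1, h2]
  have hDZrank : ∀ s ≤ N, Module.finrank K (LinearMap.range (DZ * JZ ^ s)) +
      (T'.filter (s < ·)).card = ∑ j, (z j - s) := by
    intro s hs
    refine le_antisymm ((hAZU.add_smul hMZU ε).finrank_range_le hg hDZc hzT s) ?_
    refine (le_finrank_range_model hg hMZ hμ2 hμ3 hMg s).trans ?_
    rw [card_isStart hzT]
    refine Nat.add_le_add_right ?_ _
    have h := hε3 s (by omega)
    rwa [pow_one, pow_one] at h
  have hkerD : Module.finrank K (LinearMap.ker D) ≤ T.card := by
    have h1 := le_finrank_range_model he hM hμ2 hμ3 hMe 0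
    have h2 := LinearMap.finrank_range_add_finrank_ker D
    have h3 : (Finset.univ.filter fun i => IsStart z T' i ∧ 0 < N).card ≤ T.card := by
      rw [card_isStart hzT fun _ => 0 < N]
      exact (Finset.card_filter_le _ _).trans Finset.card_image_le
    rw [pow_zero, mul_one] at h1
    rw [he.finrank_eq] at h2
    simp only [Nat.sub_zero] at h1
    omega
  have hT0 : T.filter (0 < ·) = T := Finset.filter_true_of_mem fun v hv => (hTN v hv).1
  have hb0 : ∑ j, c j + T.card = ∑ j, b j := by simpa [hT0] using hcT 0
  set p : Submodule K E := LinearMap.ker (q ∘ₗ D) with hp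
  have hker : ∀ i ≤ N, Module.finrank K (LinearMap.ker (JE ^ i) ⊓ p : Submodule K E) +
      ∑ j, (b j - i) = ∑ j, b j := by
    intro i hi
    have h1 := finrank_map_add_finrank_ker_inf (q ∘ₗ D) (LinearMap.ker (JE ^ i))
    have h2 : LinearMap.ker (JE ^ i) = LinearMap.range (JE ^ (N - i)) := by
      rw [he.ker_pow, he.range_pow]
    have h3 : (LinearMap.ker (JE ^ i)).map (q ∘ₗ D) = LinearMap.range (DZ * JZ ^ (N - i)) := by
      rw [h2, ← LinearMap.range_comp, ← LinearMap.range_comp_of_range_eq_top _ hqsurj]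
      congr 1
      refine LinearMap.ext fun x => ?_
      change q (D ((JE ^ (N - i)) x)) = DZ ((JZ ^ (N - i)) (q x))
      rw [hqD, hqpow]
    have h4 : Module.finrank K (LinearMap.ker (JE ^ i)) = t * i := by
      rw [h2, hrE, show N - (N - i) = i by omega]
    have h5 := hDZrank (N - i) (by omega)
    have h6 : ∑ j, (z j - (N - i)) + ∑ j, c j = t * i + ∑ j, (c j - i) := by
      rw [show t * i = ∑ _ : Fin t, i by simp, ← Finset.sum_add_distrib, ← Finset.sum_add_distrib]
      refine Finset.sum_congr rfl fun j _ => ?_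
      have := hz j
      omega
    have h7 := hcT i
    have h8 := hT'card i hi
    rw [h3, h4, ← hp, inf_comm] at h1
    omega
  have hpfin : Module.finrank K p = ∑ j, b j := by
    have h1 := hker N le_rfl
    rw [hJN, LinearMap.ker_zero, top_inf_eq] at h1
    rw [← h1, Finset.sum_eq_zero fun j _ => Nat.sub_eq_zero_of_le (hbN j).le, add_zero]
  have hpmap : ∀ i, Module.finrank K (p.map (JE ^ i)) = ∑ j, (b j - i) := by
    intro i
    rcases le_total i N with hi | hi
    · have h1 := finrank_map_add_finrank_ker_inf (JE ^ i) p
      have h2 := hker i hi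
      omega
    · rw [← Nat.sub_add_cancel hi, pow_add, hJN, mul_zero, Submodule.map_zero, finrank_bot]
      exact (Finset.sum_eq_zero fun j _ => by have := hbN j; omega).symm
  have hpD : p.map D = LinearMap.range ι := by
    refine Submodule.eq_of_le_of_finrank_le ?_ ?_
    · rw [hex]
      rintro _ ⟨y, hy, rfl⟩
      exact hy
    · have h1 := finrank_map_add_finrank_ker_inf D p
      have h2 := Submodule.finrank_mono (inf_le_left : LinearMap.ker D ⊓ p ≤ _)
      have h3 := LinearMap.finrank_range_le ι
      rw [hw.finrank_eq] at h3
      omega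
  obtain ⟨A₁, h1, h2, h3⟩ := exists_commute_of_map_pow_eq hx he.isNilpotent hDc hDn (p := p)
    (fun y hy => by
      rw [hp, LinearMap.mem_ker, LinearMap.comp_apply] at hy ⊢
      have := hcomm hDc 1 y
      rw [pow_one] at this
      rw [this, hq, hy, map_zero])
    (fun y hy => by
      rw [hp, LinearMap.mem_ker, LinearMap.comp_apply] at hy ⊢
      rw [hqD, hy, map_zero]) hpmap
  refine ⟨A₁, h1, h2, ?_⟩
  rw [h3, pow_succ, Module.End.mul_eq_comp, Submodule.map_comp, hpD, ← hP, ← LinearMap.range_comp]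
  refine le_trans ?_ hε1
  have hAιm : (A ^ m) ∘ₗ ι = ι ∘ₗ A' ^ m := by
    clear hε1
    induction m with
    | zero => rfl
    | succ n ih =>
      rw [pow_succ, pow_succ, Module.End.mul_eq_comp, Module.End.mul_eq_comp, LinearMap.comp_assoc,
        hAι, ← LinearMap.comp_assoc, ih, LinearMap.comp_assoc]
  rw [Module.End.mul_eq_comp, LinearMap.range_comp, hP, ← LinearMap.range_comp, hAιm,
    LinearMap.range_comp]
  exact (Submodule.equivMapOfInjective ι (LinearMap.ker_eq_bot.1 hιinj) _).finrank_eq.le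

end Down

section Combinatorics

variable {t : ℕ} {b : Fin t → ℕ} {T T' T'' : Finset ℕ}

theorem IsTops.card_le {ι : Type*} {b : ι → ℕ} (hT : IsTops b T) {P : Finset ℕ} {s : ℕ}
    (hP : ∀ v ∈ P, s < v ∧ ∃ j, b j = v) (hP' : ∀ v ∈ P, v + 1 ∉ P) :
    P.card ≤ (T.filter (s < ·)).card := by
  classical
  refine Finset.card_le_card_of_injOn (fun v => if v ∈ T then v else v + 1) (fun v hv => ?_) ?_
  · obtain ⟨h1, h2⟩ := hP v hv
    simp only [Finset.coe_filter, Set.mem_ofPred_eq]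
    split_ifs with h
    · exact ⟨h, h1⟩
    · refine ⟨?_, by omega⟩
      by_contra h3
      exact h ((hT v).2 ⟨by omega, h2, h3⟩)
  · intro v hv w hw hvw
    have h1 : v + 1 ≠ w := fun h => hP' v hv (h ▸ hw)
    have h2 : w + 1 ≠ v := fun h => hP' w hw (h ▸ hv)
    simp only at hvw
    split_ifs at hvw <;> omega

theorem card_filter_le_of_delTops (hT : IsTops b T) (hT' : IsTops (delTops b T) T') (s : ℕ) :
    (T.filter (s + 1 < ·)).card ≤ (T'.filter (s < ·)).card := by
  classical
  have h : ((T.filter (s + 1 < ·)).image (· - 1)).card = (T.filter (s + 1 < ·)).card := by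
    refine Finset.card_image_of_injOn fun v hv w hw hvw => ?_
    simp only [Finset.coe_filter, Set.mem_ofPred_eq] at hv hw hvw
    omega
  rw [← h]
  refine hT'.card_le ?_ ?_
  · simp only [Finset.mem_image, Finset.mem_filter]
    rintro _ ⟨v, ⟨hv, hv'⟩, rfl⟩
    obtain ⟨i, hi, rfl⟩ := exists_isStart hT hv
    exact ⟨by omega, i, by simp only [delTops, if_pos hi]⟩
  · simp only [Finset.mem_image, Finset.mem_filter]
    rintro _ ⟨v, ⟨hv, hv'⟩, rfl⟩ ⟨w, ⟨hw, hw'⟩, hvw⟩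
    exact ((hT v).1 hv).2.2 (by rwa [show v + 1 = w by omega])

theorem card_le_card_add_one_of_delTops (hT : IsTops b T) (hT' : IsTops (delTops b T) T')
    (hT'' : IsTops (delTops (delTops b T) T') T'') : T.card ≤ T''.card + 1 := by
  have h1 := card_filter_le_of_delTops hT hT' 1
  have h2 := card_filter_le_of_delTops hT' hT'' 0
  simp only [zero_add] at h2
  have h3 : (T''.filter (0 < ·)).card ≤ T''.card := Finset.card_filter_le _ _
  have h4 : (T.filter fun v => ¬ 1 + 1 < v).card ≤ 1 := by
    rw [Finset.card_le_one]
    simp only [Finset.mem_filter]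
    rintro v ⟨hv, hv'⟩ w ⟨hw, hw'⟩
    have h5 := (hT v).1 hv
    have h6 := (hT w).1 hw
    by_contra hne
    rcases Nat.lt_or_gt_of_ne hne with h | h
    · exact h5.2.2 (by rwa [show v + 1 = w by omega])
    · exact h6.2.2 (by rwa [show w + 1 = v by omega])
  have h5 := Finset.card_filter_add_card_filter_not (s := T) (1 + 1 < ·)
  omega

theorem add_two_le_of_sum_sub {z : ℕ} {lam : Fin z → ℕ} (hpos : ∀ i, 0 < lam i)
    (hmono : ∀ i j : Fin z, i ≤ j → lam j ≤ lam i)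
    (h : ∀ m, ∑ i, (lam i - m) + ∑ i, (lam i - (m + 3)) ≤
      ∑ i, (lam i - (m + 1)) + ∑ i, (lam i - (m + 2)) + 1)
    {i j : Fin z} (hij : i < j) : lam j + 2 ≤ lam i := by
  by_contra hlt
  have hj := hpos j
  have hji := hmono i j hij.le
  set m := lam j - 1
  have h1 : ∑ i, (lam i - m) + ∑ i, (lam i - (m + 3)) =
      ∑ i, (lam i - (m + 1)) + ∑ i, (lam i - (m + 2)) +
        (Finset.univ.filter fun i => lam i = m + 1 ∨ lam i = m + 2).card := by
    rw [Finset.card_filter, ← Finset.sum_add_distrib, ← Finset.sum_add_distrib,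
      ← Finset.sum_add_distrib]
    refine Finset.sum_congr rfl fun k _ => ?_
    split_ifs <;> omega
  have h2 : ({i, j} : Finset (Fin z)) ⊆
      Finset.univ.filter fun i => lam i = m + 1 ∨ lam i = m + 2 := by
    intro k hk
    simp only [Finset.mem_insert, Finset.mem_singleton] at hk
    simp only [Finset.mem_filter, Finset.mem_univ, true_and]
    rcases hk with rfl | rfl <;> omega
  have h3 := Finset.card_le_card h2
  rw [Finset.card_pair hij.ne] at h3
  have := h m
  omega

end Combinatorics

section Main

variable {K : Type*} [Field K]

/-- The maximal value of `rank (A ^ m)`, over nilpotent `A` commuting with `J`, is `a m`. -/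
def IsMaxRank {V : Type*} [AddCommGroup V] [Module K V] (J : Module.End K V) (a : ℕ → ℕ) : Prop :=
  ∀ m, (∀ A, Commute A J → IsNilpotent A → Module.finrank K (LinearMap.range (A ^ m)) ≤ a m) ∧
    ∃ A, Commute A J ∧ IsNilpotent A ∧ Module.finrank K (LinearMap.range (A ^ m)) = a m

theorem IsMaxRank.apply_zero {V ι : Type*} [AddCommGroup V] [Module K V] [Fintype ι]
    {J : Module.End K V} {b : ι → ℕ} {e : ι → V} {a : ℕ → ℕ} (ha : IsMaxRank J a)
    (he : IsAdapted J b e) : a 0 = ∑ j, b j := by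
  obtain ⟨A, -, -, h⟩ := (ha 0).2
  rw [← h, pow_zero, Module.End.one_eq_id, LinearMap.range_id, finrank_top, he.finrank_eq]

variable [Infinite K] {t : ℕ} {b : Fin t → ℕ} {T : Finset ℕ} {a : ℕ → ℕ}

theorem IsMaxRank.of_isTops (ha : IsMaxRank (Matrix.toLin' (jordanMatrix K t b)) a)
    (hT : IsTops b T) :
    IsMaxRank (Matrix.toLin' (jordanMatrix K t (delTops b T))) fun m => a (m + 1) := by
  obtain ⟨e, he⟩ := exists_isAdapted_jordanMatrix K b
  obtain ⟨f, hf⟩ := exists_isAdapted_jordanMatrix K (delTops b T)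
  have hle : ∀ m A, Commute A (Matrix.toLin' (jordanMatrix K t (delTops b T))) →
      IsNilpotent A → Module.finrank K (LinearMap.range (A ^ m)) ≤ a (m + 1) := by
    intro m A' hA' hAn'
    obtain ⟨A, hA, hAn, h⟩ := exists_finrank_range_pow_le he hf hT (sum_delTops hT) hA' hAn' m
    exact h.trans ((ha _).1 A hA hAn)
  refine fun m => ⟨hle m, ?_⟩
  obtain ⟨A, hA, hAn, h⟩ := (ha (m + 1)).2
  obtain ⟨A', hA', hAn', h'⟩ := exists_le_finrank_range_pow_succ he hf hT (sum_delTops hT) hA hAn m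
  exact ⟨A', hA', hAn', le_antisymm (hle m A' hA' hAn') (h.symm.trans_le h')⟩

theorem IsMaxRank.add_le (ha : IsMaxRank (Matrix.toLin' (jordanMatrix K t b)) a) (m : ℕ) :
    a m + a (m + 3) ≤ a (m + 1) + a (m + 2) + 1 := by
  induction m generalizing b a with
  | zero =>
    obtain ⟨T, hT⟩ := exists_isTops b
    obtain ⟨T', hT'⟩ := exists_isTops (delTops b T)
    obtain ⟨T'', hT''⟩ := exists_isTops (delTops (delTops b T) T')
    have hzero : ∀ {b : Fin t → ℕ} {a : ℕ → ℕ},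
        IsMaxRank (Matrix.toLin' (jordanMatrix K t b)) a → a 0 = ∑ j, b j := fun {b} _ h =>
      h.apply_zero (exists_isAdapted_jordanMatrix K b).choose_spec
    have hsum : ∀ {b : Fin t → ℕ} {T : Finset ℕ}, IsTops b T →
        ∑ j, delTops b T j + T.card = ∑ j, b j := fun {b T} h => by
      have := sum_delTops h 0
      rwa [Finset.filter_true_of_mem fun v hv => ((h v).1 hv).1] at this
    have h0 := hzero ha
    have h1 := hzero (ha.of_isTops hT)
    have h2 := hzero ((ha.of_isTops hT).of_isTops hT')
    have h3 := hzero (((ha.of_isTops hT).of_isTops hT').of_isTops hT'')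
    have h4 := hsum hT
    have h5 := hsum hT''
    have h6 := card_le_card_add_one_of_delTops hT hT' hT''
    simp only [Nat.zero_add, Nat.reduceAdd] at h1 h2 h3 ⊢
    omega
  | succ m ih =>
    obtain ⟨T, hT⟩ := exists_isTops b
    exact ih (ha.of_isTops hT)

theorem finrank_range_pow_le_of_separated (hb : ∀ i j, i ≠ j → 0 < b i → b i ≤ b j → b i + 2 ≤ b j)
    {A : Module.End K ((Σ i : Fin t, Fin (b i)) → K)}
    (hA : Commute A (Matrix.toLin' (jordanMatrix K t b))) (hAn : IsNilpotent A) (m : ℕ) :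
    Module.finrank K (LinearMap.range (A ^ m)) ≤ ∑ j, (b j - m) := by
  classical
  induction m generalizing b with
  | zero =>
    obtain ⟨e, he⟩ := exists_isAdapted_jordanMatrix K b
    exact (Submodule.finrank_le _).trans he.finrank_eq.le
  | succ m ih =>
    obtain ⟨e, he⟩ := exists_isAdapted_jordanMatrix K b
    obtain ⟨f, hf⟩ := exists_isAdapted_jordanMatrix K fun j => b j - 1
    set T := (Finset.univ.image b).filter (0 < ·) with hTdef
    have hmem : ∀ v, v ∈ T ↔ 0 < v ∧ ∃ j, b j = v := fun v => by
      simp [hTdef, and_comm]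
    have hT : IsTops b T := by
      intro v
      rw [← and_assoc, ← hmem, iff_self_and, hmem, hmem]
      rintro ⟨hv, i, rfl⟩ ⟨-, j, hj⟩
      have := hb i j (by rintro rfl; omega) hv (by omega)
      omega
    have hc : ∀ s, ∑ j, (b j - 1 - s) + (T.filter (s < ·)).card = ∑ j, (b j - s) := by
      intro s
      have h1 : T.filter (s < ·) = (Finset.univ.filter fun j => s < b j).image b := by
        ext v
        simp only [Finset.mem_filter, hmem, Finset.mem_image, Finset.mem_univ, true_and]
        constructor
        · rintro ⟨⟨-, j, rfl⟩, h⟩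
          exact ⟨j, h, rfl⟩
        · rintro ⟨j, h, rfl⟩
          exact ⟨⟨by omega, j, rfl⟩, h⟩
      rw [h1, Finset.card_image_of_injOn, Finset.card_filter, ← Finset.sum_add_distrib]
      · refine Finset.sum_congr rfl fun j _ => ?_
        split_ifs <;> omega
      · intro i hi j _ hij
        simp only [Finset.coe_filter, Finset.mem_univ, true_and, Set.mem_ofPred_eq] at hi
        by_contra hne
        have := hb i j hne (by omega) hij.le
        omega
    obtain ⟨A', hA', hAn', h⟩ := exists_le_finrank_range_pow_succ he hf hT hc hA hAn m
    refine h.trans ((ih (fun i j hij h1 h2 => ?_) hA' hAn').trans_eq ?_)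
    · have := hb i j hij (by omega) (by omega)
      omega
    · exact Finset.sum_congr rfl fun j _ => by omega

end Main

theorem rank_eq_finrank_range_toLin' {K n : Type*} [Field K] [Fintype n] [DecidableEq n]
    (A : Matrix n n K) (m : ℕ) :
    (A ^ m).rank = Module.finrank K (LinearMap.range (Matrix.toLin' A ^ m)) := by
  rw [← Matrix.toLin'_pow, Matrix.rank_eq_finrank_range_toLin _ (Pi.basisFun K n) (Pi.basisFun K n),
    Matrix.toLin_eq_toLin']

/-- (Košir–Oblak.) Suppose `K` is an infinite field.  Let `A₀` be an element of `N_B` of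
maximal Jordan type `Q(B) = (λ_1, ..., λ_z)` (so `rank A₀^m = Σ_i (λ_i - m)⁺` for all `m`).
Then `λ_i - λ_{i+1} ≥ 2` for all `i`, and consequently `Q(Q(B)) = Q(B)`:
every nilpotent matrix commuting with a Jordan matrix `J'` of type `Q(B)` has
`rank A^m ≤ rank J'^m` for all `m`, i.e. the map `Q` is idempotent. -/
theorem Q_idempotent
    (K : Type*) [Field K] [Infinite K]
    (t : ℕ) (μ : Fin t → ℕ) (hpos : ∀ i, 0 < μ i)
    (hmono : ∀ i j : Fin t, i ≤ j → μ j ≤ μ i)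
    (A₀ : Matrix (Σ i : Fin t, Fin (μ i)) (Σ i : Fin t, Fin (μ i)) K)
    (hA₀J : A₀ * jordanMatrix K t μ = jordanMatrix K t μ * A₀)
    (hA₀nil : IsNilpotent A₀)
    (hA₀max : ∀ A : Matrix (Σ i : Fin t, Fin (μ i)) (Σ i : Fin t, Fin (μ i)) K,
      A * jordanMatrix K t μ = jordanMatrix K t μ * A → IsNilpotent A →
      ∀ m : ℕ, (A ^ m).rank ≤ (A₀ ^ m).rank)
    (z : ℕ) (lam : Fin z → ℕ) (hlampos : ∀ i, 0 < lam i)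
    (hlammono : ∀ i j : Fin z, i ≤ j → lam j ≤ lam i)
    (htype : ∀ m : ℕ, (A₀ ^ m).rank = ∑ i : Fin z, (lam i - m)) :
    (∀ i : Fin z, ∀ h : (i : ℕ) + 1 < z, lam ⟨(i : ℕ) + 1, h⟩ + 2 ≤ lam i) ∧
    (∀ A : Matrix (Σ i : Fin z, Fin (lam i)) (Σ i : Fin z, Fin (lam i)) K,
        A * jordanMatrix K z lam = jordanMatrix K z lam * A → IsNilpotent A →
        ∀ m : ℕ, (A ^ m).rank ≤ (jordanMatrix K z lam ^ m).rank) := by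
  have hcomm : ∀ {r : ℕ} {b : Fin r → ℕ}
      {A : Matrix (Σ i : Fin r, Fin (b i)) (Σ i : Fin r, Fin (b i)) K},
      A * jordanMatrix K r b = jordanMatrix K r b * A →
        Commute (Matrix.toLin' A) (Matrix.toLin' (jordanMatrix K r b)) := fun h => by
    have := congrArg Matrix.toLin' h
    rwa [Matrix.toLin'_mul, Matrix.toLin'_mul] at this
  have hmax : IsMaxRank (Matrix.toLin' (jordanMatrix K t μ)) fun m => ∑ i, (lam i - m) := by
    simp only [← htype]
    refine fun m => ⟨fun A hA hAn => ?_, Matrix.toLin' A₀, hcomm hA₀J,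
      hA₀nil.map Matrix.toLinAlgEquiv', (rank_eq_finrank_range_toLin' A₀ m).symm⟩
    obtain ⟨B, rfl⟩ := Matrix.toLin'.surjective A
    rw [← rank_eq_finrank_range_toLin']
    refine hA₀max B (Matrix.toLin'.injective ?_) ?_ m
    · rw [Matrix.toLin'_mul, Matrix.toLin'_mul]
      exact hA.eq
    · exact (IsNilpotent.map_iff Matrix.toLinAlgEquiv'.injective).1 hAn
  have hsep : ∀ {i j : Fin z}, i < j → lam j + 2 ≤ lam i := fun hij =>
    add_two_le_of_sum_sub hlampos hlammono hmax.add_le hij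
  refine ⟨fun i h => hsep (Nat.lt_succ_self i), fun A hA hAn m => ?_⟩
  obtain ⟨e, he⟩ := exists_isAdapted_jordanMatrix K lam
  rw [rank_eq_finrank_range_toLin', rank_eq_finrank_range_toLin', he.finrank_range_pow]
  refine finrank_range_pow_le_of_separated (fun i j hij h1 h2 => ?_) (hcomm hA)
    (hAn.map Matrix.toLinAlgEquiv') m
  rcases lt_or_gt_of_ne hij with h | h
  · have := hsep h
    omega
  · exact hsep h
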